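/- arXiv:1607.00232 — 2 statements merged into one kernel-verified Lean document; each statement's English description precedes it below -/
import Mathlib

section
/- The moduli space of degree-d GL solutions is sequentially compact up to gauge: for every sequence (aₖ, φₖ) of degree-d GL solutions there exist a subsequence (a_{k_l}, φ_{k_l}), smooth ℤ²-periodic maps g_l : ℝ² → ℂ with |g_l(x)| = 1 for all x, and a degree-d GL solution (a, φ), such that, setting a'_l = a_{k_l} + i·conj(g_l)·(∂₁g_l, ∂₂g_l) (which is real-valued) and φ'_l = g_l·φ_{k_l}, the L² norms over [0,1]² of a'_l − a, of φ'_l − φ, and of all first-order partial derivatives of a'_l − a and φ'_l − φ, all tend to 0 as l → ∞. -/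
open MeasureTheory Complex

noncomputable section

/-- Partial derivative in the first coordinate direction. -/
def pd1 {E : Type*} [NormedAddCommGroup E] [NormedSpace ℝ E]
    (f : ℝ × ℝ → E) (x : ℝ × ℝ) : E := fderiv ℝ f x (1, 0)

/-- Partial derivative in the second coordinate direction. -/
def pd2 {E : Type*} [NormedAddCommGroup E] [NormedSpace ℝ E]
    (f : ℝ × ℝ → E) (x : ℝ × ℝ) : E := fderiv ℝ f x (0, 1)

/-- Covariant derivative `D₁φ = ∂₁φ + i a₁ φ`. -/
def D1 (a1 : ℝ × ℝ → ℝ) (φ : ℝ × ℝ → ℂ) : ℝ × ℝ → ℂ :=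
  fun x => pd1 φ x + Complex.I * (a1 x : ℂ) * φ x

/-- Covariant derivative `D₂φ = ∂₂φ + i a₂ φ`. -/
def D2 (a2 : ℝ × ℝ → ℝ) (φ : ℝ × ℝ → ℂ) : ℝ × ℝ → ℂ :=
  fun x => pd2 φ x + Complex.I * (a2 x : ℂ) * φ x

/-- Curvature `F(a) = ∂₁a₂ − ∂₂a₁`. -/
def curv (a1 a2 : ℝ × ℝ → ℝ) : ℝ × ℝ → ℝ :=
  fun x => pd1 a2 x - pd2 a1 x

/-- The fundamental domain `[0,1]²`. -/
def unitSquare : Set (ℝ × ℝ) := Set.Icc (0, 0) (1, 1)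

/-- A degree-`d` field pair on the torus: smooth quasi-periodic `(a, φ)`. -/
structure FieldPair (d : ℤ) where
  a1 : ℝ × ℝ → ℝ
  a2 : ℝ × ℝ → ℝ
  φ : ℝ × ℝ → ℂ
  smooth_a1 : ContDiff ℝ (⊤ : ℕ∞) a1
  smooth_a2 : ContDiff ℝ (⊤ : ℕ∞) a2
  smooth_φ : ContDiff ℝ (⊤ : ℕ∞) φ
  per1_a1 : ∀ x : ℝ × ℝ, a1 (x.1 + 1, x.2) = a1 x
  per1_a2 : ∀ x : ℝ × ℝ, a2 (x.1 + 1, x.2) = a2 x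
  per1_φ : ∀ x : ℝ × ℝ, φ (x.1 + 1, x.2) = φ x
  per2_a2 : ∀ x : ℝ × ℝ, a2 (x.1, x.2 + 1) = a2 x
  per2_a1 : ∀ x : ℝ × ℝ, a1 (x.1, x.2 + 1) = a1 x - 2 * Real.pi * d
  per2_φ : ∀ x : ℝ × ℝ, φ (x.1, x.2 + 1) =
      Complex.exp (2 * Real.pi * Complex.I * (d : ℂ) * (x.1 : ℂ)) * φ x

/-- The smooth ℤ²-periodic external field with `∫_{[0,1]²} F₀ = 2πd`. -/
def ExternalField (d : ℤ) (F₀ : ℝ × ℝ → ℝ) : Prop :=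
  ContDiff ℝ (⊤ : ℕ∞) F₀ ∧ (∀ x : ℝ × ℝ, F₀ (x.1 + 1, x.2) = F₀ x) ∧
    (∀ x : ℝ × ℝ, F₀ (x.1, x.2 + 1) = F₀ x) ∧
    (∫ x in unitSquare, F₀ x) = 2 * Real.pi * d

/-- The Ginzburg–Landau free energy. -/
def energy (α β : ℝ) (F₀ : ℝ × ℝ → ℝ) {d : ℤ} (P : FieldPair d) : ℝ :=
  (1 / 2) * ∫ x in unitSquare,
    ((curv P.a1 P.a2 x - F₀ x) ^ 2 + ‖D1 P.a1 P.φ x‖ ^ 2 + ‖D2 P.a2 P.φ x‖ ^ 2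
      - α * ‖P.φ x‖ ^ 2 + (β / 2) * ‖P.φ x‖ ^ 4)

/-- The Ginzburg–Landau equations. -/
def IsGLSolution (α β : ℝ) (F₀ : ℝ × ℝ → ℝ) {d : ℤ} (P : FieldPair d) : Prop :=
  (∀ x : ℝ × ℝ,
      pd2 (fun y => curv P.a1 P.a2 y - F₀ y) x
        + ((starRingEnd ℂ) (P.φ x) * D1 P.a1 P.φ x).im = 0) ∧
  (∀ x : ℝ × ℝ,
      -pd1 (fun y => curv P.a1 P.a2 y - F₀ y) x
        + ((starRingEnd ℂ) (P.φ x) * D2 P.a2 P.φ x).im = 0) ∧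
  (∀ x : ℝ × ℝ,
      -(D1 P.a1 (D1 P.a1 P.φ) x + D2 P.a2 (D2 P.a2 P.φ) x)
        = (α : ℂ) * P.φ x - (β : ℂ) * (‖P.φ x‖ : ℂ) ^ 2 * P.φ x)

/-- The set of energies of all degree-`d` field pairs. -/
def energySet (α β : ℝ) (F₀ : ℝ × ℝ → ℝ) (d : ℤ) : Set ℝ :=
  { t : ℝ | ∃ P : FieldPair d, t = energy α β F₀ P }

/-- `λ₁`, the lowest eigenvalue of the covariant Laplacian among connections
with curvature `F₀`. -/
def lambda1 (d : ℤ) (F₀ : ℝ × ℝ → ℝ) : ℝ :=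
  sInf { t : ℝ | ∃ P : FieldPair d,
    (∀ x : ℝ × ℝ, curv P.a1 P.a2 x = F₀ x) ∧
    (∫ x in unitSquare, ‖P.φ x‖ ^ 2) = 1 ∧
    t = ∫ x in unitSquare, (‖D1 P.a1 P.φ x‖ ^ 2 + ‖D2 P.a2 P.φ x‖ ^ 2) }

/-- The gauge-transformed first component `a₁ + i·conj(g)·∂₁g` (real part taken;
the quantity is real-valued when `|g| ≡ 1`). -/
def gaugeA1 (g : ℝ × ℝ → ℂ) (a1 : ℝ × ℝ → ℝ) : ℝ × ℝ → ℝ :=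
  fun x => a1 x + (Complex.I * (starRingEnd ℂ) (g x) * pd1 g x).re

/-- The gauge-transformed second component `a₂ + i·conj(g)·∂₂g`. -/
def gaugeA2 (g : ℝ × ℝ → ℂ) (a2 : ℝ × ℝ → ℝ) : ℝ × ℝ → ℝ :=
  fun x => a2 x + (Complex.I * (starRingEnd ℂ) (g x) * pd2 g x).re

/-- The gauge-transformed section `g·φ`. -/
def gaugePhi (g : ℝ × ℝ → ℂ) (φ : ℝ × ℝ → ℂ) : ℝ × ℝ → ℂ :=
  fun x => g x * φ x

/-- Squared `L²` norm over the fundamental domain `[0,1]²`. -/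
def sqL2 {E : Type*} [NormedAddCommGroup E] (f : ℝ × ℝ → E) : ℝ :=
  ∫ x in unitSquare, ‖f x‖ ^ 2

/-- Families of smooth complex functions on the plane. -/
def Sm (ι : Type) : Subalgebra ℂ (ι → ℝ × ℝ → ℂ) where
  carrier := {f | ∀ k, ContDiff ℝ (⊤ : ℕ∞) (f k)}
  mul_mem' hf hg k := (hf k).mul (hg k)
  add_mem' hf hg k := (hf k).add (hg k)
  algebraMap_mem' _ _ := contDiff_const

namespace Sm

variable {ι : Type}

/-- Coordinate directions. -/
def dir : Fin 2 → ℝ × ℝ := ![(1, 0), (0, 1)]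

lemma smooth (f : Sm ι) (k : ι) : ContDiff ℝ (⊤ : ℕ∞) (f.1 k) := f.2 k

lemma diff (f : Sm ι) (k : ι) : Differentiable ℝ (f.1 k) :=
  (smooth f k).differentiable (by simp)

@[ext] lemma ext {f g : Sm ι} (h : ∀ k x, f.1 k x = g.1 k x) : f = g :=
  Subtype.ext (funext fun k => funext fun x => h k x)

@[simp] lemma mul_ev (f g : Sm ι) (k x) : (f * g).1 k x = f.1 k x * g.1 k x := rfl
@[simp] lemma add_ev (f g : Sm ι) (k x) : (f + g).1 k x = f.1 k x + g.1 k x := rfl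
@[simp] lemma sub_ev (f g : Sm ι) (k x) : (f - g).1 k x = f.1 k x - g.1 k x := rfl
@[simp] lemma neg_ev (f : Sm ι) (k x) : (-f).1 k x = -f.1 k x := rfl
@[simp] lemma zero_ev (k x) : (0 : Sm ι).1 k x = 0 := rfl
@[simp] lemma one_ev (k x) : (1 : Sm ι).1 k x = 1 := rfl
@[simp] lemma intCast_ev (n : ℤ) (k x) : (n : Sm ι).1 k x = n := rfl
@[simp] lemma natCast_ev (n : ℕ) (k x) : (n : Sm ι).1 k x = n := rfl
@[simp] lemma two_ev (k x) : (2 : Sm ι).1 k x = 2 := by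
  rw [← one_add_one_eq_two, add_ev, one_ev, one_add_one_eq_two]

/-- Families that do not depend on the point of the plane. -/
def cst : (ι → ℂ) →+* Sm ι where
  toFun c := ⟨fun k _ => c k, fun _ => contDiff_const⟩
  map_one' := rfl
  map_mul' _ _ := rfl
  map_zero' := rfl
  map_add' _ _ := rfl

@[simp] lemma cst_ev (c : ι → ℂ) (k x) : (cst c).1 k x = c k := rfl

/-- Complex conjugation. -/
def cj : Sm ι →+* Sm ι where
  toFun f := ⟨fun k x => starRingEnd ℂ (f.1 k x), fun k =>
    Complex.conjCLE.contDiff.comp (smooth f k)⟩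
  map_one' := by ext; simp
  map_mul' _ _ := by ext; simp
  map_zero' := by ext; simp
  map_add' _ _ := by ext; simp

@[simp] lemma cj_ev (f : Sm ι) (k x) : (cj f).1 k x = starRingEnd ℂ (f.1 k x) := rfl

@[simp] lemma cj_cj (f : Sm ι) : cj (cj f) = f := by ext; simp

/-- Partial derivatives. -/
def der (i : Fin 2) : Derivation ℂ (Sm ι) (Sm ι) :=
  Derivation.mk'
    { toFun := fun f => ⟨fun k x => fderiv ℝ (f.1 k) x (dir i), fun k =>
        ((smooth f k).fderiv_right (m := (⊤ : ℕ∞)) (by simp)).clm_apply contDiff_const⟩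
      map_add' := fun f g => by
        ext k x
        change fderiv ℝ (fun y => f.1 k y + g.1 k y) x (dir i) = _
        rw [fderiv_fun_add (diff f k x) (diff g k x)]; rfl
      map_smul' := fun c f => by
        ext k x
        change fderiv ℝ (fun y => c • f.1 k y) x (dir i) = _
        rw [fderiv_fun_const_smul (diff f k x)]; rfl }
    (fun f g => by
        ext k x
        change fderiv ℝ (fun y => f.1 k y * g.1 k y) x (dir i) = _
        rw [fderiv_fun_mul (diff f k x) (diff g k x)]; rfl)

lemma der_ev (i : Fin 2) (f : Sm ι) (k x) : (der i f).1 k x = fderiv ℝ (f.1 k) x (dir i) := rfl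

@[simp] lemma der_mul (i : Fin 2) (f g : Sm ι) : der i (f * g) = der i f * g + f * der i g := by
  rw [Derivation.leibniz, smul_eq_mul, smul_eq_mul]; ring

@[simp] lemma der_cst (i : Fin 2) (c : ι → ℂ) : der i (cst c) = 0 := by
  ext k x
  change fderiv ℝ (fun _ => c k) x (dir i) = 0
  simp

@[simp] lemma der_intCast (i : Fin 2) (n : ℤ) : der i (n : Sm ι) = 0 := der_cst i _

@[simp] lemma der_cj (i : Fin 2) (f : Sm ι) : der i (cj f) = cj (der i f) := by
  ext k x
  change fderiv ℝ (fun y => Complex.conjCLE (f.1 k y)) x (dir i) = Complex.conjCLE _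
  have := (Complex.conjCLE.toContinuousLinearMap.hasFDerivAt.comp x (diff f k x).hasFDerivAt).fderiv
  exact congrArg (fun L => L (dir i)) this

lemma der_comm (i j : Fin 2) (f : Sm ι) : der i (der j f) = der j (der i f) := by
  ext k x
  have h : ContDiffAt ℝ (⊤ : ℕ∞) (f.1 k) x := (smooth f k).contDiffAt
  have hd : DifferentiableAt ℝ (fderiv ℝ (f.1 k)) x :=
    ((smooth f k).fderiv_right (m := (⊤ : ℕ∞)) (by simp)).differentiable (by simp) x
  have e : ∀ i j : Fin 2, (der i (der j f)).1 k x =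
      fderiv ℝ (fderiv ℝ (f.1 k)) x (dir i) (dir j) := by
    intro i j
    change fderiv ℝ (fun y => fderiv ℝ (f.1 k) y (dir j)) x (dir i) = _
    rw [fderiv_clm_apply hd (differentiableAt_const _)]
    simp
  rw [e, e]
  exact (h.isSymmSndFDerivAt (by
    rw [minSmoothness_of_isRCLikeNormedField]; exact WithTop.coe_le_coe.2 (le_top (a := (2 : ℕ∞))))) _ _

/-- The imaginary unit. -/
def II : Sm ι := cst fun _ => I

@[simp] lemma II_ev (k : ι) (x) : (II : Sm ι).1 k x = I := rfl
@[simp] lemma der_II (i : Fin 2) : der i (II : Sm ι) = 0 := der_cst i _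
@[simp] lemma cj_II : cj (II : Sm ι) = -II := by ext; simp

/-- Covariant derivative of a section of charge `q`. -/
def cov (a : Fin 2 → Sm ι) (q : ℤ) (i : Fin 2) (ψ : Sm ι) : Sm ι :=
  der i ψ + II * (q : Sm ι) * a i * ψ

/-- Curvature components. -/
def crv (a : Fin 2 → Sm ι) (i j : Fin 2) : Sm ι := der i (a j) - der j (a i)

variable {a : Fin 2 → Sm ι}

lemma cov_zero (i : Fin 2) (ψ : Sm ι) : cov a 0 i ψ = der i ψ := by simp [cov]

lemma cov_mul (p q : ℤ) (i : Fin 2) (ψ χ : Sm ι) :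
    cov a (p + q) i (ψ * χ) = cov a p i ψ * χ + ψ * cov a q i χ := by
  simp only [cov, der_mul]; push_cast; ring

lemma cov_add (q : ℤ) (i : Fin 2) (ψ χ : Sm ι) :
    cov a q i (ψ + χ) = cov a q i ψ + cov a q i χ := by
  simp only [cov, map_add]; ring

lemma cov_cst_mul (q : ℤ) (i : Fin 2) (c : ι → ℂ) (ψ : Sm ι) :
    cov a q i (cst c * ψ) = cst c * cov a q i ψ := by
  simp only [cov, der_mul, der_cst]; ring

lemma cov_cj (ha : ∀ i, cj (a i) = a i) (q : ℤ) (i : Fin 2) (ψ : Sm ι) :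
    cov a (-q) i (cj ψ) = cj (cov a q i ψ) := by
  simp only [cov, der_cj, map_add, map_mul, cj_II, ha, map_intCast]; push_cast; ring

lemma cov_comm (q : ℤ) (i j : Fin 2) (ψ : Sm ι) :
    cov a q i (cov a q j ψ) = cov a q j (cov a q i ψ) + II * (q : Sm ι) * crv a i j * ψ := by
  simp only [cov, crv, map_add, der_mul, der_II, der_intCast, der_comm i j ψ]; ring

/-- Covariant Laplacian. -/
def lap (a : Fin 2 → Sm ι) (q : ℤ) (ψ : Sm ι) : Sm ι := ∑ i, cov a q i (cov a q i ψ)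

lemma cov_fun_mul (q : ℤ) (i : Fin 2) (f ψ : Sm ι) :
    cov a q i (f * ψ) = der i f * ψ + f * cov a q i ψ := by
  simp only [cov, der_mul]; ring

lemma cov_sum (q : ℤ) (i : Fin 2) (ψ : Fin 2 → Sm ι) :
    cov a q i (∑ j, ψ j) = ∑ j, cov a q i (ψ j) := by
  simp only [Fin.sum_univ_two, cov_add]

lemma lap_cov (q : ℤ) (j : Fin 2) (ψ : Sm ι) :
    lap a q (cov a q j ψ) = cov a q j (lap a q ψ) +
      ∑ i, II * (q : Sm ι) * (2 * crv a i j * cov a q i ψ + der i (crv a i j) * ψ) := by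
  rw [lap, lap, cov_sum, ← Finset.sum_add_distrib]
  refine Finset.sum_congr rfl fun i _ => ?_
  have e : II * (q : Sm ι) * crv a i j * ψ = (II * (q : Sm ι)) * (crv a i j * ψ) := by ring
  rw [cov_comm q i j ψ, cov_add, cov_comm q i j (cov a q i ψ), e, cov_fun_mul, cov_fun_mul]
  simp only [der_mul, der_II, der_intCast]
  ring

lemma lap_normSq (ha : ∀ i, cj (a i) = a i) (q : ℤ) (ψ : Sm ι) :
    lap a 0 (ψ * cj ψ) = 2 * ∑ i, cov a q i ψ * cj (cov a q i ψ) +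
      (lap a q ψ * cj ψ + ψ * cj (lap a q ψ)) := by
  simp only [lap, map_sum, Finset.mul_sum, Finset.sum_mul, ← Finset.sum_add_distrib]
  refine Finset.sum_congr rfl fun i _ => ?_
  have h0 : (0 : ℤ) = q + -q := by ring
  rw [h0, cov_mul, cov_cj ha, cov_add, cov_mul, cov_mul, cov_cj ha, cov_cj ha]
  ring

end Sm

namespace Sm

variable {ι : Type} {a : Fin 2 → Sm ι} {W : ι → ℝ × ℝ → ℝ}

/-- Covariant derivatives of order less than `n` are uniformly bounded, and those of order `n` are
bounded by a multiple of `1 + W`. -/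
def Est (a : Fin 2 → Sm ι) (W : ι → ℝ × ℝ → ℝ) : ℕ → ℤ → Sm ι → Prop
  | 0, _, ψ => ∃ C, ∀ k x, ‖ψ.1 k x‖ ≤ C * (1 + W k x)
  | n + 1, q, ψ => (∃ C, ∀ k x, ‖ψ.1 k x‖ ≤ C) ∧ ∀ i, Est a W n q (cov a q i ψ)

lemma Est.of_bdd_zero (hW : ∀ k x, 0 ≤ W k x) {q : ℤ} {ψ : Sm ι}
    (h : ∃ C, ∀ k x, ‖ψ.1 k x‖ ≤ C) : Est a W 0 q ψ := by
  obtain ⟨C, hC⟩ := h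
  refine ⟨C, fun k x => (hC k x).trans ?_⟩
  have := (norm_nonneg _).trans (hC k x)
  nlinarith [hW k x]

lemma Est.of_succ (hW : ∀ k x, 0 ≤ W k x) {n : ℕ} {q : ℤ} {ψ : Sm ι}
    (h : Est a W (n + 1) q ψ) : Est a W n q ψ := by
  induction n generalizing ψ with
  | zero => exact .of_bdd_zero hW h.1
  | succ n ih => exact ⟨h.1, fun i => ih (h.2 i)⟩

lemma Est.to_zero {n : ℕ} {q : ℤ} {ψ : Sm ι}
    (h : Est a W (n + 1) q ψ) : Est a 0 n q ψ := by
  induction n generalizing ψ with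
  | zero => exact .of_bdd_zero (fun _ _ => le_rfl) h.1
  | succ n ih => exact ⟨h.1, fun i => ih (h.2 i)⟩

lemma Est.bdd {n : ℕ} {q : ℤ} {ψ : Sm ι} (h : Est a 0 n q ψ) : ∃ C, ∀ k x, ‖ψ.1 k x‖ ≤ C := by
  cases n with
  | zero => simpa [Est] using h
  | succ n => exact h.1

lemma Est.add {n : ℕ} {q : ℤ} {ψ χ : Sm ι}
    (h : Est a W n q ψ) (h' : Est a W n q χ) : Est a W n q (ψ + χ) := by
  induction n generalizing ψ χ with
  | zero =>
    obtain ⟨C, hC⟩ := h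
    obtain ⟨C', hC'⟩ := h'
    refine ⟨C + C', fun k x => (norm_add_le _ _).trans ?_⟩
    linarith [hC k x, hC' k x]
  | succ n ih =>
    obtain ⟨⟨C, hC⟩, h⟩ := h
    obtain ⟨⟨C', hC'⟩, h'⟩ := h'
    refine ⟨⟨C + C', fun k x => (norm_add_le _ _).trans ?_⟩, fun i => ?_⟩
    · linarith [hC k x, hC' k x]
    · rw [cov_add]; exact ih (h i) (h' i)

lemma Est.cst_mul {n : ℕ} {q : ℤ} {ψ : Sm ι} (c : ℂ)
    (h : Est a W n q ψ) : Est a W n q (cst (fun _ => c) * ψ) := by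
  induction n generalizing ψ with
  | zero =>
    obtain ⟨C, hC⟩ := h
    refine ⟨‖c‖ * C, fun k x => ?_⟩
    simp only [mul_ev, cst_ev, norm_mul, mul_assoc]
    gcongr
    exact hC k x
  | succ n ih =>
    obtain ⟨⟨C, hC⟩, h⟩ := h
    refine ⟨⟨‖c‖ * C, fun k x => ?_⟩, fun i => ?_⟩
    · simp only [mul_ev, cst_ev, norm_mul]
      gcongr
      exact hC k x
    · rw [cov_cst_mul]; exact ih (h i)

lemma Est.cj (ha : ∀ i, cj (a i) = a i) {n : ℕ} {q : ℤ} {ψ : Sm ι}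
    (h : Est a W n q ψ) : Est a W n (-q) (cj ψ) := by
  induction n generalizing ψ with
  | zero => simpa [Est] using h
  | succ n ih =>
    refine ⟨by simpa using h.1, fun i => ?_⟩
    rw [cov_cj ha]; exact ih (h.2 i)

lemma bdd_mul {ψ χ : Sm ι} (h : ∃ C, ∀ k x, ‖ψ.1 k x‖ ≤ C) (h' : ∃ C, ∀ k x, ‖χ.1 k x‖ ≤ C) :
    ∃ C, ∀ k x, ‖(ψ * χ).1 k x‖ ≤ C := by
  obtain ⟨C, hC⟩ := h
  obtain ⟨C', hC'⟩ := h'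
  refine ⟨C * C', fun k x => ?_⟩
  rw [mul_ev, norm_mul]
  exact mul_le_mul (hC k x) (hC' k x) (norm_nonneg _) ((norm_nonneg _).trans (hC k x))

lemma Est.mul_succ (hW : ∀ k x, 0 ≤ W k x) {n : ℕ} {p q : ℤ} {ψ χ : Sm ι}
    (h : Est a W n p ψ) (h' : Est a W (n + 1) q χ) : Est a W n (p + q) (ψ * χ) := by
  induction n generalizing ψ χ with
  | zero =>
    obtain ⟨C, hC⟩ := h
    obtain ⟨C', hC'⟩ := h'.1
    refine ⟨C * C', fun k x => ?_⟩
    rw [mul_ev, norm_mul, mul_right_comm]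
    exact mul_le_mul (hC k x) (hC' k x) (norm_nonneg _) ((norm_nonneg _).trans (hC k x))
  | succ n ih =>
    refine ⟨bdd_mul h.1 h'.1, fun i => ?_⟩
    rw [cov_mul]
    exact (ih (h.2 i) (h'.of_succ hW)).add (ih (h.of_succ hW) (h'.2 i))

lemma Est.succ_mul (hW : ∀ k x, 0 ≤ W k x) {n : ℕ} {p q : ℤ} {ψ χ : Sm ι}
    (h : Est a W (n + 1) p ψ) (h' : Est a W n q χ) : Est a W n (p + q) (ψ * χ) := by
  rw [mul_comm, add_comm]; exact h'.mul_succ hW h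

lemma Est.mul (hW : ∀ k x, 0 ≤ W k x) {n : ℕ} {p q : ℤ} {ψ χ : Sm ι}
    (h : Est a W (n + 1) p ψ) (h' : Est a W (n + 1) q χ) : Est a W (n + 1) (p + q) (ψ * χ) := by
  refine ⟨bdd_mul h.1 h'.1, fun i => ?_⟩
  rw [cov_mul]
  exact ((h.2 i).mul_succ hW h').add (h.succ_mul hW (h'.2 i))

/-- The sum of the squared norms of the covariant derivatives of order `n`. -/
def V (a : Fin 2 → Sm ι) (q : ℤ) : ℕ → Sm ι → Sm ι
  | 0, ψ => ψ * cj ψ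
  | n + 1, ψ => ∑ i, V a q n (cov a q i ψ)

lemma V_succ (q : ℤ) (n : ℕ) (ψ : Sm ι) :
    V a q (n + 1) ψ = V a q n (cov a q 0 ψ) + V a q n (cov a q 1 ψ) := by
  rw [V, Fin.sum_univ_two]

lemma V_zero_ev (q : ℤ) (ψ : Sm ι) (k x) : (V a q 0 ψ).1 k x = ((‖ψ.1 k x‖ ^ 2 : ℝ) : ℂ) := by
  simp [V, Complex.mul_conj, Complex.normSq_eq_norm_sq]

lemma V_zero_re (q : ℤ) (ψ : Sm ι) (k x) : ((V a q 0 ψ).1 k x).re = ‖ψ.1 k x‖ ^ 2 := by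
  rw [V_zero_ev, Complex.ofReal_re]

lemma V_nonneg (q : ℤ) (n : ℕ) (ψ : Sm ι) (k x) : 0 ≤ ((V a q n ψ).1 k x).re := by
  induction n generalizing ψ with
  | zero => rw [V_zero_re]; positivity
  | succ n ih => rw [V_succ]; exact add_nonneg (ih _) (ih _)

lemma V_cov_le (q : ℤ) (n : ℕ) (ψ : Sm ι) (i : Fin 2) (k x) :
    ((V a q n (cov a q i ψ)).1 k x).re ≤ ((V a q (n + 1) ψ).1 k x).re := by
  rw [V_succ, add_ev, Complex.add_re]
  have h0 := V_nonneg (a := a) q n (cov a q 0 ψ) k x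
  have h1 := V_nonneg (a := a) q n (cov a q 1 ψ) k x
  fin_cases i <;> simp <;> linarith

lemma Est.of_V_le_zero (hW : ∀ k x, 0 ≤ W k x) {q : ℤ} {ψ : Sm ι}
    (h : ∀ k x, ((V a q 0 ψ).1 k x).re ≤ W k x ^ 2) : Est a W 0 q ψ := by
  refine ⟨1, fun k x => ?_⟩
  have := h k x
  rw [V_zero_re] at this
  have := abs_le_of_sq_le_sq this (hW k x)
  rw [abs_le] at this
  linarith

lemma Est.of_V_le (hW : ∀ k x, 0 ≤ W k x) {n : ℕ} {q : ℤ} {ψ : Sm ι} (h0 : Est a 0 n q ψ)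
    (h : ∀ k x, ((V a q (n + 1) ψ).1 k x).re ≤ W k x ^ 2) : Est a W (n + 1) q ψ := by
  induction n generalizing ψ with
  | zero => exact ⟨h0.bdd, fun i => .of_V_le_zero hW fun k x => (V_cov_le q 0 ψ i k x).trans (h k x)⟩
  | succ n ih =>
    exact ⟨h0.1, fun i => ih (h0.2 i) fun k x => (V_cov_le q _ ψ i k x).trans (h k x)⟩

lemma Est.V_bdd {n : ℕ} {q : ℤ} {ψ : Sm ι} (h : Est a 0 n q ψ) :
    ∃ C, ∀ k x, ((V a q n ψ).1 k x).re ≤ C := by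
  induction n generalizing ψ with
  | zero =>
    obtain ⟨C, hC⟩ := h.bdd
    refine ⟨C ^ 2, fun k x => ?_⟩
    rw [V_zero_re]
    exact pow_le_pow_left₀ (norm_nonneg _) (hC k x) 2
  | succ n ih =>
    obtain ⟨C, hC⟩ := ih (h.2 0)
    obtain ⟨C', hC'⟩ := ih (h.2 1)
    refine ⟨C + C', fun k x => ?_⟩
    rw [V_succ, add_ev, Complex.add_re]
    exact add_le_add (hC k x) (hC' k x)

lemma Est.of_W_bdd (hW : ∃ C, ∀ k x, W k x ≤ C) (hW0 : ∀ k x, 0 ≤ W k x) {n : ℕ} {q : ℤ} {ψ : Sm ι}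
    (h : Est a W n q ψ) : Est a 0 n q ψ := by
  induction n generalizing ψ with
  | zero =>
    obtain ⟨B, hB⟩ := hW
    obtain ⟨C, hC⟩ := h
    refine .of_bdd_zero (fun _ _ => le_rfl) ⟨|C| * (1 + B), fun k x => (hC k x).trans ?_⟩
    exact mul_le_mul (le_abs_self C) (by linarith [hB k x]) (by linarith [hW0 k x]) (abs_nonneg C)
  | succ n ih => exact ⟨h.1, fun i => ih (h.2 i)⟩

lemma lap_add (q : ℤ) (ψ χ : Sm ι) : lap a q (ψ + χ) = lap a q ψ + lap a q χ := by
  simp only [lap, cov_add, Finset.sum_add_distrib]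

lemma lap_cst_mul (q : ℤ) (c : ι → ℂ) (ψ : Sm ι) : lap a q (cst c * ψ) = cst c * lap a q ψ := by
  simp only [lap, cov_cst_mul, Finset.mul_sum]

lemma Est.lap_cov (hW : ∀ k x, 0 ≤ W k x) {m : ℕ} {q : ℤ} {ψ : Sm ι}
    (h : Est a W (m + 1) q ψ) (hl : Est a W (m + 1) q (lap a q ψ))
    (hF : ∀ i j, Est a W (m + 1) 0 (crv a i j)) (j : Fin 2) :
    Est a W m q (lap a q (cov a q j ψ)) := by
  rw [Sm.lap_cov]
  refine (hl.2 j).add ?_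
  have key : ∀ i, Est a W m q
      (II * (q : Sm ι) * (2 * crv a i j * cov a q i ψ + der i (crv a i j) * ψ)) := by
    intro i
    have e : II * (q : Sm ι) * (2 * crv a i j * cov a q i ψ + der i (crv a i j) * ψ) =
        cst (fun _ => I * q) * (cst (fun _ => 2) * (crv a i j * cov a q i ψ)
          + der i (crv a i j) * ψ) := by
      ext k x; simp only [mul_ev, add_ev, cst_ev, II_ev, intCast_ev, two_ev]; ring
    rw [e]
    refine (Est.add (.cst_mul _ ?_) ?_).cst_mul _
    · have := (hF i j).succ_mul hW (h.2 i)
      rwa [zero_add] at this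
    · have := (hF i j).2 i
      rw [cov_zero] at this
      have := this.mul_succ hW h
      rwa [zero_add] at this
  rw [Fin.sum_univ_two]
  exact (key 0).add (key 1)

lemma lap_V_zero (ha : ∀ i, Sm.cj (a i) = a i) (q : ℤ) (ψ : Sm ι) {A B : ℝ} {k : ι} {x : ℝ × ℝ}
    (hA : ‖ψ.1 k x‖ ≤ A) (hB : ‖(lap a q ψ).1 k x‖ ≤ B) :
    2 * ((V a q 1 ψ).1 k x).re - 2 * (A * B) ≤ ((lap a 0 (V a q 0 ψ)).1 k x).re := by
  have e : V a q 0 ψ = ψ * Sm.cj ψ := rfl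
  have e' : ∑ i, cov a q i ψ * Sm.cj (cov a q i ψ) = V a q 1 ψ := rfl
  rw [e, lap_normSq ha, e']
  have h1 : ‖(lap a q ψ).1 k x * starRingEnd ℂ (ψ.1 k x)‖ ≤ A * B := by
    rw [norm_mul, RCLike.norm_conj, mul_comm]
    exact mul_le_mul hA hB (norm_nonneg _) ((norm_nonneg _).trans hA)
  have h2 : ‖ψ.1 k x * starRingEnd ℂ ((lap a q ψ).1 k x)‖ ≤ A * B := by
    rw [norm_mul, RCLike.norm_conj, mul_comm, ← RCLike.norm_conj (ψ.1 k x), ← norm_mul]; exact h1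
  have h1' := (abs_le.1 ((Complex.abs_re_le_norm _).trans h1)).1
  have h2' := (abs_le.1 ((Complex.abs_re_le_norm _).trans h2)).1
  simp only [add_ev, mul_ev, cj_ev, two_ev, Complex.add_re]
  have : ((2 : ℂ) * (V a q 1 ψ).1 k x).re = 2 * ((V a q 1 ψ).1 k x).re := by simp
  linarith

theorem Est.lap_V (ha : ∀ i, Sm.cj (a i) = a i) (hW : ∀ k x, 0 ≤ W k x) {m : ℕ} {q : ℤ} {ψ : Sm ι}
    (h : Est a W m q ψ) (hl : Est a W m q (lap a q ψ))
    (hF : ∀ i j, Est a W m 0 (crv a i j)) :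
    ∃ C, ∀ k x, 2 * ((V a q (m + 1) ψ).1 k x).re - C * (1 + W k x) ^ 2 ≤
      ((lap a 0 (V a q m ψ)).1 k x).re := by
  induction m generalizing ψ with
  | zero =>
    obtain ⟨C, hC⟩ := h
    obtain ⟨C', hC'⟩ := hl
    refine ⟨2 * (C * C'), fun k x => ?_⟩
    have := lap_V_zero ha q ψ (hC k x) (hC' k x)
    simp only [zero_add]
    linarith
  | succ m ih =>
    obtain ⟨C, hC⟩ := ih (h.2 0) (.lap_cov hW h hl hF 0) (fun i j => (hF i j).of_succ hW)
    obtain ⟨C', hC'⟩ := ih (h.2 1) (.lap_cov hW h hl hF 1) (fun i j => (hF i j).of_succ hW)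
    refine ⟨C + C', fun k x => ?_⟩
    rw [V_succ q m ψ, V_succ q (m + 1) ψ, lap_add]
    simp only [add_ev, Complex.add_re]
    linarith [hC k x, hC' k x]

end Sm

lemma ContDiff.fderiv_fderiv_nonpos_of_isMax {E : Type*} [NormedAddCommGroup E] [NormedSpace ℝ E]
    {f : E → ℝ} (hf : ContDiff ℝ (⊤ : ℕ∞) f) {p : E} (hp : ∀ x, f x ≤ f p) (v : E) :
    fderiv ℝ (fun y => fderiv ℝ f y v) p v ≤ 0 := by
  have hd : Differentiable ℝ f := hf.differentiable (by simp)
  have hf' : ContDiff ℝ (⊤ : ℕ∞) (fun y => fderiv ℝ f y v) :=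
    (hf.fderiv_right (m := (⊤ : ℕ∞)) (by simp)).clm_apply contDiff_const
  have line : ∀ t : ℝ, HasDerivAt (fun t : ℝ => p + t • v) v t := fun t => by
    simpa using ((hasDerivAt_id t).smul_const v).const_add p
  have along : ∀ g : E → ℝ, Differentiable ℝ g → ∀ t : ℝ,
      HasDerivAt (fun t : ℝ => g (p + t • v)) (fderiv ℝ g (p + t • v) v) t := fun g hg t =>
    (hg _).hasFDerivAt.comp_hasDerivAt t (line t)
  have d1 : deriv (fun t : ℝ => f (p + t • v)) = fun t => fderiv ℝ f (p + t • v) v :=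
    funext fun t => (along f hd t).deriv
  have d2 : deriv (deriv fun t : ℝ => f (p + t • v)) 0 =
      fderiv ℝ (fun y => fderiv ℝ f y v) p v := by
    rw [d1, (along _ (hf'.differentiable (by simp)) 0).deriv, zero_smul, add_zero]
  have hmax : IsLocalMax (fun t : ℝ => f (p + t • v)) 0 :=
    Filter.Eventually.of_forall fun t => by simpa using hp _
  rw [← d2]
  by_contra! hpos
  have hmin := isLocalMin_of_deriv_deriv_pos hpos hmax.deriv_eq_zero
    (along f hd 0).continuousAt
  have hconst : (fun t : ℝ => f (p + t • v)) =ᶠ[nhds 0] fun _ => f (p + (0 : ℝ) • v) := by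
    filter_upwards [hmax, hmin] with t h h' using le_antisymm h h'
  have : deriv (deriv fun t : ℝ => f (p + t • v)) 0 = 0 := by
    rw [hconst.deriv.deriv_eq]; simp
  linarith

/-- Periodicity with respect to the integer lattice. -/
def Per {E : Type*} (f : ℝ × ℝ → E) : Prop :=
  (∀ x : ℝ × ℝ, f (x.1 + 1, x.2) = f x) ∧ ∀ x : ℝ × ℝ, f (x.1, x.2 + 1) = f x

lemma Per.comp {E F : Type*} {f : ℝ × ℝ → E} (hf : Per f) (g : E → F) : Per fun x => g (f x) :=
  ⟨fun x => congrArg g (hf.1 x), fun x => congrArg g (hf.2 x)⟩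

lemma Per.exists_mem_unitSquare {E : Type*} {f : ℝ × ℝ → E} (hf : Per f) (x : ℝ × ℝ) :
    ∃ y ∈ unitSquare, f x = f y := by
  refine ⟨(Int.fract x.1, Int.fract x.2), ?_, ?_⟩
  · exact ⟨⟨Int.fract_nonneg _, Int.fract_nonneg _⟩, (Int.fract_lt_one _).le, (Int.fract_lt_one _).le⟩
  · have p1 : Function.Periodic (fun s => f (s, x.2)) 1 := fun s => hf.1 (s, x.2)
    have p2 : Function.Periodic (fun s => f (Int.fract x.1, s)) 1 := fun s => hf.2 (_, s)
    have h1 := p1.sub_int_mul_eq (x := x.1) ⌊x.1⌋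
    have h2 := p2.sub_int_mul_eq (x := x.2) ⌊x.2⌋
    simp only [mul_one, Int.self_sub_floor] at h1 h2
    rw [h2, h1]

lemma isCompact_unitSquare : IsCompact unitSquare := isCompact_Icc

lemma unitSquare_nonempty : unitSquare.Nonempty := ⟨(0, 0), by simp [unitSquare]⟩

lemma Per.exists_max {f : ℝ × ℝ → ℝ} (hf : Per f) (hc : Continuous f) : ∃ p, ∀ x, f x ≤ f p := by
  obtain ⟨p, -, hp⟩ := isCompact_unitSquare.exists_isMaxOn unitSquare_nonempty hc.continuousOn
  refine ⟨p, fun x => ?_⟩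
  obtain ⟨y, hy, e⟩ := hf.exists_mem_unitSquare x
  exact e ▸ hp hy

lemma Per.exists_bound {E : Type*} [NormedAddCommGroup E] {f : ℝ × ℝ → E} (hf : Per f)
    (hc : Continuous f) : ∃ C, ∀ x, ‖f x‖ ≤ C := by
  obtain ⟨p, hp⟩ := (hf.comp norm).exists_max hc.norm
  exact ⟨_, hp⟩

namespace Sm
variable {ι : Type} {a : Fin 2 → Sm ι}

lemma exists_max (f : Sm ι) (k : ι) (hf : Per (f.1 k)) :
    ∃ p, (∀ x, (f.1 k x).re ≤ (f.1 k p).re) ∧ ((lap a 0 f).1 k p).re ≤ 0 := by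
  have hs : ContDiff ℝ (⊤ : ℕ∞) (fun x => (f.1 k x).re) :=
    Complex.reCLM.contDiff.comp (smooth f k)
  obtain ⟨p, hp⟩ := (hf.comp Complex.re).exists_max hs.continuous
  have hre : ∀ (g : Sm ι) (x v), fderiv ℝ (fun y => (g.1 k y).re) x v =
      (fderiv ℝ (g.1 k) x v).re := by
    intro g x v
    have := (Complex.reCLM.hasFDerivAt.comp x (diff g k x).hasFDerivAt).fderiv
    exact congrArg (fun L => L v) this
  refine ⟨p, hp, ?_⟩
  have key : ∀ i, ((der i (der i f)).1 k p).re ≤ 0 := by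
    intro i
    have h := hs.fderiv_fderiv_nonpos_of_isMax hp (dir i)
    have e : (fun y => fderiv ℝ (fun x => (f.1 k x).re) y (dir i)) =
      fun y => ((der i f).1 k y).re := funext fun y => hre f y (dir i)
    rw [e, hre] at h
    exact h
  simp only [lap, Fin.sum_univ_two, cov_zero, add_ev, Complex.add_re]
  linarith [key 0, key 1]

/-- Families of solutions of the Ginzburg–Landau equations with uniformly smooth external field. -/
structure IsGL (α β : ℝ) (F₀ : Sm ι) (a : Fin 2 → Sm ι) (φ : Sm ι) : Prop where
  real : ∀ i, cj (a i) = a i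
  est_F₀ : ∀ n, Est a 0 n 0 F₀
  per_V : ∀ n k, Per ((V a 1 n φ).1 k)
  osc : ∀ k M, (∀ x, ‖(der 0 (crv a 0 1 - F₀)).1 k x‖ + ‖(der 1 (crv a 0 1 - F₀)).1 k x‖ ≤ M) →
    ∀ x, ‖(crv a 0 1 - F₀).1 k x‖ ≤ M
  eq_one : der 1 (crv a 0 1 - F₀) =
    cst (fun _ => I / 2) * (cj φ * cov a 1 0 φ + cst (fun _ => -1) * (φ * cj (cov a 1 0 φ)))
  eq_zero : der 0 (crv a 0 1 - F₀) =
    cst (fun _ => -I / 2) * (cj φ * cov a 1 1 φ + cst (fun _ => -1) * (φ * cj (cov a 1 1 φ)))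
  eq_lap : lap a 1 φ = cst (fun _ => -(α : ℂ)) * φ + cst (fun _ => (β : ℂ)) * (φ * cj φ * φ)

variable {α β : ℝ} {F₀ φ : Sm ι} {W : ι → ℝ × ℝ → ℝ}

lemma Est.of_zero (hW : ∀ k x, 0 ≤ W k x) {n : ℕ} {q : ℤ} {ψ : Sm ι} (h : Est a 0 n q ψ) :
    Est a W n q ψ := by
  induction n generalizing ψ with
  | zero => exact .of_bdd_zero hW h.bdd
  | succ n ih => exact ⟨h.1, fun i => ih (h.2 i)⟩

namespace IsGL

lemma norm_sq_le (h : IsGL α β F₀ a φ) (hα : 0 < α) (hβ : 0 < β) (k x) : ((V a 1 0 φ).1 k x).re ≤ α / β := by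
  obtain ⟨p, hp, hl⟩ := exists_max (a := a) (V a 1 0 φ) k (h.per_V 0 k)
  refine (hp x).trans ?_
  have e : V a 1 0 φ = φ * cj φ := rfl
  have e' : ∑ i, cov a 1 i φ * Sm.cj (cov a 1 i φ) = V a 1 1 φ := rfl
  rw [e, lap_normSq h.real 1, e', h.eq_lap] at hl
  have n1 := V_nonneg (a := a) 1 1 φ k p
  rw [V_zero_re]
  have e3 : φ.1 k p * starRingEnd ℂ (φ.1 k p) = ((‖φ.1 k p‖ ^ 2 : ℝ) : ℂ) := by
    rw [Complex.mul_conj, Complex.normSq_eq_norm_sq]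
  set u := ‖φ.1 k p‖ ^ 2
  have e2 : ((2 * V a 1 1 φ + ((cst (fun _ => -(α : ℂ)) * φ + cst (fun _ => (β : ℂ)) *
      (φ * cj φ * φ)) * cj φ + φ * cj (cst (fun _ => -(α : ℂ)) * φ + cst (fun _ => (β : ℂ)) *
      (φ * cj φ * φ)))).1 k p) = 2 * (V a 1 1 φ).1 k p + 2 * ((-α * u + β * u * u : ℝ) : ℂ) := by
    simp only [add_ev, mul_ev, two_ev, cst_ev, cj_ev, map_add, map_mul, map_neg, Complex.conj_conj,
      Complex.conj_ofReal]
    push_cast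
    linear_combination (2 * (-α : ℂ) + 2 * β * (φ.1 k p * starRingEnd ℂ (φ.1 k p) + u)) * e3
  rw [e2] at hl
  have : ((2 * (V a 1 1 φ).1 k p + 2 * ((-α * u + β * u * u : ℝ) : ℂ))).re =
    2 * ((V a 1 1 φ).1 k p).re + 2 * (-α * u + β * u * u) := by
    simp only [Complex.add_re, Complex.mul_re, Complex.ofReal_re, Complex.ofReal_im, Complex.re_ofNat,
      Complex.im_ofNat]; ring
  rw [this] at hl
  rw [le_div_iff₀ hβ]
  by_contra! hc
  have hu : 0 ≤ u := by positivity
  rcases hu.eq_or_lt with h0 | h0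
  · rw [← h0] at hc hl; nlinarith
  · nlinarith [mul_pos h0 (sub_pos.2 hc)]

end IsGL
end Sm

namespace Sm
variable {ι : Type} {a : Fin 2 → Sm ι} {α β : ℝ} {F₀ φ : Sm ι} {W : ι → ℝ × ℝ → ℝ}
namespace IsGL

lemma est_zero (h : IsGL α β F₀ a φ) (hα : 0 < α) (hβ : 0 < β) : Est a 0 0 1 φ := by
  refine .of_bdd_zero (fun _ _ => le_rfl) ⟨Real.sqrt (α / β), fun k x => ?_⟩
  have := h.norm_sq_le hα hβ k x
  rw [V_zero_re] at this
  exact Real.le_sqrt_of_sq_le this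

lemma est_current (h : IsGL α β F₀ a φ) (hW : ∀ k x, 0 ≤ W k x) {m : ℕ}
    (hφ : Est a W (m + 1) 1 φ) (i : Fin 2) (c : ℂ) :
    Est a W m 0 (cst (fun _ => c) * (cj φ * cov a 1 i φ +
      cst (fun _ => -1) * (φ * cj (cov a 1 i φ)))) := by
  refine (Est.add ?_ (Est.cst_mul _ ?_)).cst_mul _
  · exact (hφ.cj h.real).succ_mul hW (hφ.2 i)
  · exact hφ.succ_mul hW ((hφ.2 i).cj h.real)

lemma est_der_field (h : IsGL α β F₀ a φ) (hW : ∀ k x, 0 ≤ W k x) {m : ℕ}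
    (hφ : Est a W (m + 1) 1 φ) (i : Fin 2) : Est a W m 0 (der i (crv a 0 1 - F₀)) := by
  fin_cases i
  · simp only [Fin.zero_eta]; rw [h.eq_zero]; exact h.est_current hW hφ 1 _
  · simp only [Fin.mk_one]; rw [h.eq_one]; exact h.est_current hW hφ 0 _

lemma est_crv (h : IsGL α β F₀ a φ) (hW : ∀ k x, 0 ≤ W k x) {m : ℕ}
    (hφ : Est a W (m + 1) 1 φ) (hb : ∃ C, ∀ k x, ‖(crv a 0 1 - F₀).1 k x‖ ≤ C) (i j : Fin 2) :
    Est a W (m + 1) 0 (crv a i j) := by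
  have h01 : Est a W (m + 1) 0 (crv a 0 1) := by
    have e : crv a 0 1 = (crv a 0 1 - F₀) + F₀ := by ring
    rw [e]
    refine Est.add ⟨hb, fun i => ?_⟩ ((h.est_F₀ _).of_zero hW)
    rw [cov_zero]; exact h.est_der_field hW hφ i
  have e10 : crv a 1 0 = cst (fun _ => -1) * crv a 0 1 := by
    ext; simp [crv]
  have e0 : ∀ i, crv a i i = cst (fun _ => 0) * crv a 0 1 := by
    intro i; ext; simp [crv]
  fin_cases i <;> fin_cases j <;> simp only [Fin.zero_eta, Fin.mk_one]
  · rw [e0]; exact h01.cst_mul _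
  · exact h01
  · rw [e10]; exact h01.cst_mul _
  · rw [e0]; exact h01.cst_mul _

lemma est_lap (h : IsGL α β F₀ a φ) (hW : ∀ k x, 0 ≤ W k x) {m : ℕ}
    (hφ : Est a W (m + 1) 1 φ) : Est a W (m + 1) 1 (lap a 1 φ) := by
  rw [h.eq_lap]
  exact (hφ.cst_mul _).add ((((hφ.mul hW (hφ.cj h.real)).mul hW hφ)).cst_mul _)

lemma bdd_lap (h : IsGL α β F₀ a φ) (hα : 0 < α) (hβ : 0 < β) :
    ∃ C, ∀ k x, ‖(lap a 1 φ).1 k x‖ ≤ C := by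
  rw [h.eq_lap]
  have hb := (h.est_zero hα hβ).bdd
  have hc : ∃ C, ∀ k x, ‖(cj φ).1 k x‖ ≤ C := by simpa using hb
  have key : ∀ c : ℂ, ∃ C, ∀ (k : ι) (x : ℝ × ℝ), ‖(cst (fun _ => c) : Sm ι).1 k x‖ ≤ C :=
    fun c => ⟨‖c‖, fun _ _ => le_rfl⟩
  have h1 := bdd_mul (key (-(α : ℂ))) hb
  have h2 := bdd_mul (key (β : ℂ)) (bdd_mul (bdd_mul hb hc) hb)
  obtain ⟨C, hC⟩ := h1
  obtain ⟨C', hC'⟩ := h2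
  exact ⟨C + C', fun k x => (norm_add_le _ _).trans (add_le_add (hC k x) (hC' k x))⟩

/-- A priori bound for the gradient in terms of the lower-order term, by the maximum principle. -/
lemma V_le_of_lap (h : IsGL α β F₀ a φ) {n : ℕ} {k : ι} {A B C K : ℝ} (hA : 0 < A)
    (hK : K = 2 * A)
    (h1 : ∀ x, -A * (1 + ((V a 1 (n + 1) φ).1 k x).re) ≤ ((lap a 0 (V a 1 (n + 1) φ)).1 k x).re)
    (h0 : ∀ x, 2 * ((V a 1 (n + 1) φ).1 k x).re - B ≤ ((lap a 0 (V a 1 n φ)).1 k x).re)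
    (hC : ∀ x, ((V a 1 n φ).1 k x).re ≤ C) (x) :
    ((V a 1 (n + 1) φ).1 k x).re ≤ 1 + B + K * C := by
  obtain ⟨p, hp, hl⟩ := exists_max (a := a) (V a 1 (n + 1) φ + cst (fun _ => (K : ℂ)) * V a 1 n φ) k
    ⟨fun x => by simp [(h.per_V _ k).1], fun x => by simp [(h.per_V _ k).2]⟩
  rw [lap_add, lap_cst_mul] at hl
  simp only [add_ev, mul_ev, cst_ev, Complex.add_re, Complex.re_ofReal_mul] at hl hp
  have hK0 : 0 < K := by linarith
  have b1 := h1 p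
  have b2 := mul_le_mul_of_nonneg_left (h0 p) hK0.le
  have hx := hp x
  have b3 := mul_nonneg hK0.le (V_nonneg (a := a) 1 n φ k x)
  have b4 := mul_le_mul_of_nonneg_left (hC p) hK0.le
  have n1 := V_nonneg (a := a) 1 (n + 1) φ k p
  have b5 : ((V a 1 (n + 1) φ).1 k p).re ≤ 1 + B := by
    subst hK
    by_contra! hc
    nlinarith [mul_pos hA (sub_pos.2 hc), mul_nonneg hA.le n1]
  linarith

lemma bdd_field (h : IsGL α β F₀ a φ) (hα : 0 < α) (hβ : 0 < β) :
    ∃ C, ∀ k x, ‖(crv a 0 1 - F₀).1 k x‖ ≤ C := by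
  set W : ι → ℝ × ℝ → ℝ := fun k x => Real.sqrt ((V a 1 1 φ).1 k x).re with hWdef
  have hW : ∀ k x, 0 ≤ W k x := fun k x => Real.sqrt_nonneg _
  have hWsq : ∀ k x, W k x ^ 2 = ((V a 1 1 φ).1 k x).re := fun k x =>
    Real.sq_sqrt (V_nonneg _ _ _ _ _)
  have hφ0 := h.est_zero hα hβ
  have hφ : Est a W 1 1 φ := .of_V_le hW hφ0 fun k x => (hWsq k x).ge
  -- bounds in terms of `W`
  have hder : ∃ C, ∀ k x, ∀ i, ‖(der i (crv a 0 1 - F₀)).1 k x‖ ≤ C * W k x := by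
    obtain ⟨C, hC⟩ := hφ0.bdd
    refine ⟨C, fun k x i => ?_⟩
    have hD : ∀ i, ‖(cov a 1 i φ).1 k x‖ ≤ W k x := fun i => by
      refine Real.le_sqrt_of_sq_le ?_
      rw [← V_zero_re (a := a) 1]; exact V_cov_le 1 0 φ i k x
    have hcur : ∀ (i : Fin 2) (c : ℂ), ‖c‖ ≤ 1 / 2 → ‖(cst (fun _ => c) * (cj φ * cov a 1 i φ +
      cst (fun _ => -1) * (φ * cj (cov a 1 i φ)))).1 k x‖ ≤ C * W k x := by
      intro i c hc
      have : ‖φ.1 k x‖ * ‖(cov a 1 i φ).1 k x‖ ≤ C * W k x :=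
        mul_le_mul (hC k x) (hD i) (norm_nonneg _) ((norm_nonneg _).trans (hC k x))
      simp only [mul_ev, add_ev, cst_ev, cj_ev, norm_mul]
      have t : ‖starRingEnd ℂ (φ.1 k x) * (cov a 1 i φ).1 k x +
          -1 * (φ.1 k x * starRingEnd ℂ ((cov a 1 i φ).1 k x))‖ ≤ 2 * (C * W k x) := by
        refine (norm_add_le _ _).trans ?_
        simp only [norm_mul, RCLike.norm_conj, norm_neg, norm_one, one_mul]
        linarith
      calc _ ≤ 1 / 2 * (2 * (C * W k x)) := mul_le_mul hc t (norm_nonneg _) (by norm_num)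
        _ = _ := by ring
    fin_cases i
    · simp only [Fin.zero_eta]; rw [h.eq_zero]; exact hcur 1 _ (by simp)
    · simp only [Fin.mk_one]; rw [h.eq_one]; exact hcur 0 _ (by simp)
  obtain ⟨c₁, hc₁⟩ := hder
  have hex : ∀ k, ∃ p, ∀ x, ((V a 1 1 φ).1 k x).re ≤ ((V a 1 1 φ).1 k p).re := fun k =>
    (exists_max (a := a) _ k (h.per_V 1 k)).imp fun p hp => hp.1
  choose p hp using hex
  set M : ι → ℝ := fun k => W k (p k) with hM
  have hM0 : ∀ k, 0 ≤ M k := fun k => hW _ _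
  have hWM : ∀ k x, W k x ≤ M k := fun k x => Real.sqrt_le_sqrt (hp k x)
  have hfield : ∀ k x, ‖(crv a 0 1 - F₀).1 k x‖ ≤ 2 * |c₁| * M k := by
    intro k
    refine h.osc k _ fun x => ?_
    have : c₁ * W k x ≤ |c₁| * M k :=
      mul_le_mul (le_abs_self _) (hWM k x) (hW _ _) (abs_nonneg _)
    linarith [hc₁ k x 0, hc₁ k x 1]
  obtain ⟨c₂, hc₂⟩ := (h.est_F₀ 0).bdd
  have hcrv : ∀ k x i j, ‖(crv a i j).1 k x‖ ≤ (2 * |c₁| + |c₂|) * (1 + M k) := by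
    intro k x i j
    have h01 : ‖(crv a 0 1).1 k x‖ ≤ (2 * |c₁| + |c₂|) * (1 + M k) := by
      have e : crv a 0 1 = (crv a 0 1 - F₀) + F₀ := by ring
      rw [e]
      refine (norm_add_le _ _).trans ?_
      nlinarith [hfield k x, hc₂ k x, le_abs_self c₂, mul_nonneg (abs_nonneg c₂) (hM0 k),
        abs_nonneg c₁]
    have e10 : crv a 1 0 = - crv a 0 1 := by ext; simp [crv]
    have e0 : ∀ i, crv a i i = 0 := fun i => by ext; simp [crv]
    have hnn : 0 ≤ (2 * |c₁| + |c₂|) * (1 + M k) :=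
      mul_nonneg (by positivity) (by linarith [hM0 k])
    fin_cases i <;> fin_cases j <;> simp only [Fin.zero_eta, Fin.mk_one]
    · rw [e0]; simpa using hnn
    · exact h01
    · rw [e10, neg_ev, norm_neg]; exact h01
    · rw [e0]; simpa using hnn
  have hlap : ∃ C, ∀ k x j, ‖(lap a 1 (cov a 1 j φ)).1 k x‖ ≤ C * (1 + M k) * (1 + W k x) := by
    have hl := h.est_lap hW hφ
    have hd : ∀ j, Est a W 0 1 (cov a 1 j φ) := hφ.2
    have hg : ∀ i j, Est a W 0 1 (der i (crv a i j) * φ) := by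
      intro i j
      have hdf : Est a W 0 0 (der i (crv a 0 1)) := by
        have e : crv a 0 1 = (crv a 0 1 - F₀) + F₀ := by ring
        rw [e, map_add]
        refine (h.est_der_field hW hφ i).add ?_
        have := ((h.est_F₀ 1).of_zero hW).2 i
        rwa [cov_zero] at this
      have e10 : der i (crv a 1 0) = cst (fun _ => -1) * der i (crv a 0 1) := by ext; simp [crv]
      have e0 : ∀ j, der i (crv a j j) = cst (fun _ => 0) * der i (crv a 0 1) := by
        intro i; ext; simp [crv]
      have : ∀ l, Est a W 0 0 (der i (crv a l j)) := by
        intro l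
        fin_cases l <;> fin_cases j <;> simp only [Fin.zero_eta, Fin.mk_one]
        · rw [e0]; exact hdf.cst_mul _
        · exact hdf
        · rw [e10]; exact hdf.cst_mul _
        · rw [e0]; exact hdf.cst_mul _
      exact (this i).mul_succ hW hφ
    have hfin : ∀ j, ∃ C, ∀ k x,
        ‖(lap a 1 (cov a 1 j φ)).1 k x‖ ≤ C * (1 + M k) * (1 + W k x) := by
      intro j
      obtain ⟨C, hC⟩ := hl.2 j
      have key : ∀ i, ∃ C, ∀ k x, ‖(II * ((1 : ℤ) : Sm ι) * (2 * crv a i j * cov a 1 i φ +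
          der i (crv a i j) * φ)).1 k x‖ ≤ C * (1 + M k) * (1 + W k x) := by
        intro i
        obtain ⟨C₁, hC₁⟩ := hd i
        obtain ⟨C₂, hC₂⟩ := hg i j
        refine ⟨2 * ((2 * |c₁| + |c₂|) * C₁) + |C₂|, fun k x => ?_⟩
        have b1 := mul_le_mul (hcrv k x i j) (hC₁ k x) (norm_nonneg _)
          ((norm_nonneg _).trans (hcrv k x i j))
        have b2 := (hC₂ k x).trans (mul_le_mul_of_nonneg_right (le_abs_self C₂)
          (by linarith [hW k x]))
        have b3 : 0 ≤ |C₂| * (M k * (1 + W k x)) :=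
          mul_nonneg (abs_nonneg _) (mul_nonneg (hM0 k) (by linarith [hW k x]))
        have e : ‖(II * ((1 : ℤ) : Sm ι) * (2 * crv a i j * cov a 1 i φ +
          der i (crv a i j) * φ)).1 k x‖ = ‖2 * (crv a i j).1 k x * (cov a 1 i φ).1 k x +
          (der i (crv a i j) * φ).1 k x‖ := by
          rw [mul_ev, norm_mul, mul_ev, norm_mul, II_ev, intCast_ev]
          simp
        rw [e]
        refine (norm_add_le _ _).trans ?_
        rw [mul_assoc, norm_mul, norm_mul, Complex.norm_ofNat]
        nlinarith
      obtain ⟨C₀, hC₀⟩ := key 0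
      obtain ⟨C₁, hC₁⟩ := key 1
      refine ⟨|C| + (C₀ + C₁), fun k x => ?_⟩
      rw [lap_cov, Fin.sum_univ_two]
      refine (norm_add_le _ _).trans ?_
      have b := norm_add_le
        ((II * ((1 : ℤ) : Sm ι) * (2 * crv a 0 j * cov a 1 0 φ + der 0 (crv a 0 j) * φ)).1 k x)
        ((II * ((1 : ℤ) : Sm ι) * (2 * crv a 1 j * cov a 1 1 φ + der 1 (crv a 1 j) * φ)).1 k x)
      have b2 := (hC k x).trans (mul_le_mul_of_nonneg_right (le_abs_self C)
          (by linarith [hW k x]))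
      have b3 : 0 ≤ |C| * (M k * (1 + W k x)) :=
          mul_nonneg (abs_nonneg _) (mul_nonneg (hM0 k) (by linarith [hW k x]))
      have b4 := hC₀ k x
      have b5 := hC₁ k x
      rw [add_ev]
      nlinarith
    obtain ⟨C₀, hC₀⟩ := hfin 0
    obtain ⟨C₁, hC₁⟩ := hfin 1
    refine ⟨max C₀ C₁, fun k x j => ?_⟩
    have hnn : 0 ≤ (1 + M k) * (1 + W k x) :=
      mul_nonneg (by linarith [hM0 k]) (by linarith [hW k x])
    rw [mul_assoc]
    fin_cases j
    · refine ((hC₀ k x).trans_eq (mul_assoc _ _ _)).trans ?_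
      exact mul_le_mul_of_nonneg_right (le_max_left _ _) hnn
    · refine ((hC₁ k x).trans_eq (mul_assoc _ _ _)).trans ?_
      exact mul_le_mul_of_nonneg_right (le_max_right _ _) hnn
  obtain ⟨c₃, hc₃⟩ := hlap
  obtain ⟨A₀, hA₀⟩ := hφ0.bdd
  obtain ⟨B₀, hB₀⟩ := h.bdd_lap hα hβ
  have hM : ∀ k, M k ^ 2 ≤ 1 + 2 * (A₀ * B₀) + 2 * (8 * |c₃| * (1 + M k) + 1) * (α / β) := by
    intro k
    rw [hWsq]
    refine h.V_le_of_lap (n := 0) (A := 8 * |c₃| * (1 + M k) + 1) ?_ rfl ?_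
      (fun x => lap_V_zero h.real 1 φ (hA₀ k x) (hB₀ k x)) (fun x => h.norm_sq_le hα hβ k x) _
    · have := mul_nonneg (abs_nonneg c₃) (by linarith [hM0 k] : 0 ≤ 1 + M k)
      linarith
    · intro x
      have hD : ∀ i, ‖(cov a 1 i φ).1 k x‖ ≤ W k x := fun i => by
        refine Real.le_sqrt_of_sq_le ?_
        rw [← V_zero_re (a := a) 1]; exact V_cov_le 1 0 φ i k x
      have l0 := lap_V_zero h.real 1 _ (hD 0) (hc₃ k x 0)
      have l1 := lap_V_zero h.real 1 _ (hD 1) (hc₃ k x 1)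
      have n0 := V_nonneg (a := a) 1 1 (cov a 1 0 φ) k x
      have n1 := V_nonneg (a := a) 1 1 (cov a 1 1 φ) k x
      have w := hWsq k x
      have w0 := hW k x
      rw [V_succ, lap_add, add_ev, Complex.add_re, ← Complex.add_re, ← add_ev, ← V_succ, ← w,
        add_ev, Complex.add_re]
      have hm : 0 ≤ 1 + M k := by linarith [hM0 k]
      have b : W k x * (c₃ * (1 + M k) * (1 + W k x)) ≤
          |c₃| * (1 + M k) * (2 * (1 + W k x ^ 2)) := by
        have t1 : W k x * (1 + W k x) ≤ 2 * (1 + W k x ^ 2) := by nlinarith [sq_nonneg (W k x - 1)]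
        calc _ = c₃ * ((1 + M k) * (W k x * (1 + W k x))) := by ring
          _ ≤ |c₃| * ((1 + M k) * (W k x * (1 + W k x))) := by
            refine mul_le_mul_of_nonneg_right (le_abs_self _) ?_
            positivity
          _ ≤ |c₃| * ((1 + M k) * (2 * (1 + W k x ^ 2))) := by gcongr
          _ = _ := by ring
      nlinarith [sq_nonneg (W k x)]
  have hαβ : 0 < α / β := div_pos hα hβ
  refine ⟨2 * |c₁| * (|1 + 2 * (A₀ * B₀) + 2 * (8 * |c₃| + 1) * (α / β)| +
    16 * |c₃| * (α / β) + 1), fun k x => (hfield k x).trans ?_⟩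
  refine mul_le_mul_of_nonneg_left ?_ (by positivity)
  have e : M k ^ 2 ≤ |1 + 2 * (A₀ * B₀) + 2 * (8 * |c₃| + 1) * (α / β)| +
      16 * |c₃| * (α / β) * M k := by
    refine (hM k).trans ?_
    have := le_abs_self (1 + 2 * (A₀ * B₀) + 2 * (8 * |c₃| + 1) * (α / β))
    nlinarith
  have d0 := abs_nonneg (1 + 2 * (A₀ * B₀) + 2 * (8 * |c₃| + 1) * (α / β))
  have e0 : 0 ≤ 16 * |c₃| * (α / β) := by positivity
  generalize |1 + 2 * (A₀ * B₀) + 2 * (8 * |c₃| + 1) * (α / β)| = D at *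
  generalize 16 * |c₃| * (α / β) = E at *
  by_contra! hc
  nlinarith [hM0 k]

/-- Uniform bounds on all covariant derivatives of the section. -/
theorem est (h : IsGL α β F₀ a φ) (hα : 0 < α) (hβ : 0 < β) (n : ℕ) : Est a 0 n 1 φ := by
  have hb := h.bdd_field hα hβ
  have h0 : ∀ (k : ι) (x : ℝ × ℝ), (0 : ℝ) ≤ (0 : ι → ℝ × ℝ → ℝ) k x := fun _ _ => le_rfl
  induction n with
  | zero => exact h.est_zero hα hβ
  | succ n ih =>
    set W : ι → ℝ × ℝ → ℝ := fun k x => Real.sqrt ((V a 1 (n + 1) φ).1 k x).re with hWdef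
    have hW : ∀ k x, 0 ≤ W k x := fun k x => Real.sqrt_nonneg _
    have hWsq : ∀ k x, W k x ^ 2 = ((V a 1 (n + 1) φ).1 k x).re := fun k x =>
      Real.sq_sqrt (V_nonneg _ _ _ _ _)
    have hφ : Est a W (n + 1) 1 φ := .of_V_le hW ih fun k x => (hWsq k x).ge
    obtain ⟨C₁, hC₁⟩ := Est.lap_V h.real hW hφ (h.est_lap hW hφ) (h.est_crv hW hφ hb)
    obtain ⟨C₀, hC₀⟩ := Est.lap_V h.real h0 ih (h.est_lap hW hφ).to_zero
      fun i j => (h.est_crv hW hφ hb i j).to_zero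
    obtain ⟨C, hC⟩ := ih.V_bdd
    refine .of_W_bdd ⟨Real.sqrt (1 + C₀ + 2 * (2 * |C₁| + 1) * C), fun k x => ?_⟩ hW hφ
    refine Real.sqrt_le_sqrt (h.V_le_of_lap (A := 2 * |C₁| + 1) (by positivity) rfl
      (fun x => ?_) (fun x => ?_) (hC k) x)
    · have b := hC₁ k x
      have n2 := V_nonneg (a := a) 1 (n + 1 + 1) φ k x
      have t : C₁ * (1 + W k x) ^ 2 ≤ |C₁| * (2 * (1 + W k x ^ 2)) :=
        mul_le_mul (le_abs_self _) (by nlinarith [sq_nonneg (W k x - 1)]) (sq_nonneg _)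
          (abs_nonneg _)
      rw [← hWsq]
      nlinarith [sq_nonneg (W k x)]
    · have b := hC₀ k x
      simpa using b

lemma est_curvature (h : IsGL α β F₀ a φ) (hα : 0 < α) (hβ : 0 < β) (n : ℕ) (i j : Fin 2) :
    Est a 0 (n + 1) 0 (crv a i j) :=
  h.est_crv (fun _ _ => le_rfl) (h.est hα hβ _) (h.bdd_field hα hβ) i j

end IsGL
end Sm

lemma abs_le_of_integral_eq_zero {h : ℝ × ℝ → ℝ} (hs : ContDiff ℝ (⊤ : ℕ∞) h) (hper : Per h)
    (h0 : ∫ x in unitSquare, h x = 0) {M : ℝ} (hM : ∀ x, |pd1 h x| + |pd2 h x| ≤ M) (x : ℝ × ℝ) :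
    |h x| ≤ M := by
  have hd : Differentiable ℝ h := hs.differentiable (by simp)
  have hfd : ∀ x, ‖fderiv ℝ h x‖ ≤ M := by
    intro x
    refine ContinuousLinearMap.opNorm_le_bound _
      ((add_nonneg (abs_nonneg _) (abs_nonneg _)).trans (hM x)) fun v => ?_
    have e : fderiv ℝ h x v = v.1 * pd1 h x + v.2 * pd2 h x := by
      have : v = v.1 • ((1 : ℝ), (0 : ℝ)) + v.2 • ((0 : ℝ), (1 : ℝ)) := by ext <;> simp
      conv_lhs => rw [this]
      rw [map_add, map_smul, map_smul]; rfl
    rw [e, Real.norm_eq_abs]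
    have v1 : |v.1| ≤ ‖v‖ := norm_fst_le v
    have v2 : |v.2| ≤ ‖v‖ := norm_snd_le v
    calc _ ≤ |v.1| * |pd1 h x| + |v.2| * |pd2 h x| := by
          rw [← abs_mul, ← abs_mul]; exact abs_add_le _ _
      _ ≤ ‖v‖ * |pd1 h x| + ‖v‖ * |pd2 h x| := by gcongr
      _ = ‖v‖ * (|pd1 h x| + |pd2 h x|) := by ring
      _ ≤ ‖v‖ * M := by gcongr; exact hM x
      _ = _ := mul_comm _ _
  have hM0 : 0 ≤ M := (norm_nonneg _).trans (hfd 0)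
  have lip : ∀ y ∈ unitSquare, ∀ z ∈ unitSquare, h y - h z ≤ M := by
    intro y hy z hz
    have := convex_univ.norm_image_sub_le_of_norm_fderiv_le (𝕜 := ℝ) (f := h) (C := M)
      (fun x _ => hd x) (fun x _ => hfd x) (Set.mem_univ z) (Set.mem_univ y)
    have hyz : ‖y - z‖ ≤ 1 := by
      obtain ⟨⟨a1, a2⟩, b1, b2⟩ := hy
      obtain ⟨⟨c1, c2⟩, d1, d2⟩ := hz
      simp only at a1 a2 b1 b2 c1 c2 d1 d2
      rw [Prod.norm_def, max_le_iff, Real.norm_eq_abs, Real.norm_eq_abs, abs_le, abs_le]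
      simp only [Prod.fst_sub, Prod.snd_sub]
      refine ⟨⟨?_, ?_⟩, ?_, ?_⟩ <;> linarith
    calc _ ≤ ‖h y - h z‖ := le_abs_self _
      _ ≤ M * ‖y - z‖ := this
      _ ≤ M * 1 := by gcongr
      _ = M := mul_one _
  have hint : IntegrableOn h unitSquare := hs.continuous.continuousOn.integrableOn_compact
    isCompact_unitSquare
  have v0 : volume unitSquare ≠ 0 := by
    rw [unitSquare, ← Set.Icc_prod_Icc]
    rw [Measure.volume_eq_prod, Measure.prod_prod]; simp
  have vt : volume unitSquare ≠ ⊤ := isCompact_unitSquare.measure_lt_top.ne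
  have av : ⨍ x in unitSquare, h x = 0 := by rw [setAverage_eq, h0, smul_zero]
  obtain ⟨y, hy, hy0⟩ := exists_le_setAverage v0 vt hint
  obtain ⟨z, hz, hz0⟩ := exists_setAverage_le v0 vt hint
  rw [av] at hy0 hz0
  obtain ⟨x', hx', e⟩ := hper.exists_mem_unitSquare x
  rw [e, abs_le]
  constructor <;> linarith [lip x' hx' y hy, lip z hz x' hx']

namespace FieldPair
variable {d : ℤ}

lemma contDiff_curv (P : FieldPair d) : ContDiff ℝ (⊤ : ℕ∞) (curv P.a1 P.a2) :=
  ((P.smooth_a2.fderiv_right (m := (⊤ : ℕ∞)) (by simp)).clm_apply contDiff_const).sub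
    ((P.smooth_a1.fderiv_right (m := (⊤ : ℕ∞)) (by simp)).clm_apply contDiff_const)

lemma integral_curv (P : FieldPair d) : ∫ x in unitSquare, curv P.a1 P.a2 x = 2 * Real.pi * d := by
  have h1 : Differentiable ℝ P.a1 := P.smooth_a1.differentiable (by simp)
  have h2 : Differentiable ℝ P.a2 := P.smooth_a2.differentiable (by simp)
  have := integral_divergence_prod_Icc_of_hasFDerivAt_of_le P.a2 (fun x => -P.a1 x)
    (fderiv ℝ P.a2) (fun x => -fderiv ℝ P.a1 x) (0, 0) (1, 1) (by simp [Prod.le_def])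
    h2.continuous.continuousOn h1.continuous.neg.continuousOn
    (fun x _ => (h2 x).hasFDerivAt) (fun x _ => (h1 x).hasFDerivAt.neg) (by
      refine ContinuousOn.integrableOn_compact isCompact_unitSquare ?_
      have := P.contDiff_curv.continuous.continuousOn (s := unitSquare)
      exact this.congr fun x _ => by simp [curv, pd1, pd2, sub_eq_add_neg])
  have e : ∀ x, curv P.a1 P.a2 x = fderiv ℝ P.a2 x (1, 0) + (-fderiv ℝ P.a1 x) (0, 1) :=
    fun x => by simp [curv, pd1, pd2, sub_eq_add_neg]
  simp only [e, unitSquare]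
  rw [this]
  have p1 : ∀ y : ℝ, P.a2 (1, y) = P.a2 (0, y) := fun y => by simpa using P.per1_a2 (0, y)
  have p2 : ∀ x : ℝ, P.a1 (x, 1) = P.a1 (x, 0) - 2 * Real.pi * d := fun x => by
    simpa using P.per2_a1 (x, 0)
  simp only [p1, p2, intervalIntegral.integral_neg]
  have hc : Continuous fun x : ℝ => P.a1 (x, 0) := h1.continuous.comp (by fun_prop)
  have hc : Continuous fun x : ℝ => P.a1 (x, 0) := h1.continuous.comp (by fun_prop)
  rw [intervalIntegral.integral_sub (hc.intervalIntegrable _ _)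
    intervalIntegrable_const]
  simp
end FieldPair

namespace Sm
variable {ι : Type} {d : ℤ}

/-- A family of real functions. -/
def ofRe (f : ι → ℝ × ℝ → ℝ) (hf : ∀ k, ContDiff ℝ (⊤ : ℕ∞) (f k)) : Sm ι :=
  ⟨fun k x => (f k x : ℂ), fun k => Complex.ofRealCLM.contDiff.comp (hf k)⟩

lemma ofRe_ev (f : ι → ℝ × ℝ → ℝ) (hf k x) : (ofRe f hf).1 k x = f k x := rfl

lemma cj_ofRe (f : ι → ℝ × ℝ → ℝ) (hf) : cj (ofRe f hf) = ofRe f hf := by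
  ext k x; simp [ofRe_ev]

lemma der_ofRe (i : Fin 2) (f : ι → ℝ × ℝ → ℝ) (hf k x) :
    (der i (ofRe f hf)).1 k x = (fderiv ℝ (f k) x (dir i) : ℝ) := by
  have := (Complex.ofRealCLM.hasFDerivAt.comp x
    ((hf k).differentiable (by simp) x).hasFDerivAt).fderiv
  exact congrArg (fun L => L (dir i)) this

/-- The gauge potentials of a family of field pairs. -/
def pot (P : ι → FieldPair d) : Fin 2 → Sm ι :=
  ![ofRe (fun k => (P k).a1) fun k => (P k).smooth_a1,
    ofRe (fun k => (P k).a2) fun k => (P k).smooth_a2]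

/-- The sections of a family of field pairs. -/
def sec (P : ι → FieldPair d) : Sm ι := ⟨fun k => (P k).φ, fun k => (P k).smooth_φ⟩

/-- Translation. -/
def shift (v : ℝ × ℝ) : Sm ι →+* Sm ι where
  toFun f := ⟨fun k x => f.1 k (x + v), fun k => (smooth f k).comp (contDiff_id.add contDiff_const)⟩
  map_one' := rfl
  map_mul' _ _ := rfl
  map_zero' := rfl
  map_add' _ _ := rfl

lemma shift_ev (v : ℝ × ℝ) (f : Sm ι) (k x) : (shift v f).1 k x = f.1 k (x + v) := rfl

lemma der_shift (i : Fin 2) (v : ℝ × ℝ) (f : Sm ι) : der i (shift v f) = shift v (der i f) := by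
  ext k x
  rw [der_ev, shift_ev, der_ev]
  have : (shift v f).1 k = fun x => f.1 k (x + v) := rfl
  rw [this, fderiv_comp_add_right]

lemma shift_cj (v : ℝ × ℝ) (f : Sm ι) : shift v (cj f) = cj (shift v f) := rfl
lemma shift_II (v : ℝ × ℝ) : shift v (II : Sm ι) = II := rfl

/-- Gauge transformations act covariantly. -/
lemma cov_gauge {a a' : Fin 2 → Sm ι} {g : Sm ι} (hg : ∀ i, der i g = II * (a i - a' i) * g)
    (i : Fin 2) (ψ : Sm ι) : cov a' 1 i (g * ψ) = g * cov a 1 i ψ := by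
  simp only [cov, der_mul, hg]; push_cast; ring

lemma V_gauge {a a' : Fin 2 → Sm ι} {g : Sm ι} (hg : ∀ i, der i g = II * (a i - a' i) * g)
    (h1 : g * cj g = 1) (n : ℕ) (ψ : Sm ι) : V a' 1 n (g * ψ) = V a 1 n ψ := by
  induction n generalizing ψ with
  | zero =>
    simp only [V, map_mul]
    linear_combination (ψ * cj ψ) * h1
  | succ n ih => simp only [V_succ, cov_gauge hg, ih]

lemma shift_cov (v : ℝ × ℝ) (a : Fin 2 → Sm ι) (i : Fin 2) (ψ : Sm ι) :
    shift v (cov a 1 i ψ) = cov (fun i => shift v (a i)) 1 i (shift v ψ) := by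
  simp [cov, der_shift, shift_II]

lemma shift_V (v : ℝ × ℝ) (a : Fin 2 → Sm ι) (n : ℕ) (ψ : Sm ι) :
    shift v (V a 1 n ψ) = V (fun i => shift v (a i)) 1 n (shift v ψ) := by
  induction n generalizing ψ with
  | zero => simp [V, shift_cj]
  | succ n ih => simp only [V_succ, map_add, ih, shift_cov]

/-- The multiplier of the sections of the degree `d` bundle. -/
def mult (ι : Type) (d : ℤ) : Sm ι :=
  ⟨fun _ x => Complex.exp (2 * Real.pi * Complex.I * (d : ℂ) * (x.1 : ℂ)), fun _ =>
    ContDiff.cexp (contDiff_const.mul (Complex.ofRealCLM.contDiff.comp contDiff_fst))⟩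

lemma mult_ev (k : ι) (x) : (mult ι d).1 k x =
  Complex.exp (2 * Real.pi * Complex.I * (d : ℂ) * (x.1 : ℂ)) := rfl

lemma mult_mul_cj : mult ι d * cj (mult ι d) = 1 := by
  ext k x
  rw [mul_ev, cj_ev, one_ev, Complex.mul_conj, Complex.normSq_eq_norm_sq, mult_ev]
  have : 2 * Real.pi * Complex.I * (d : ℂ) * (x.1 : ℂ) = ((2 * Real.pi * d * x.1 : ℝ) : ℂ) * I := by
    push_cast; ring
  rw [this, Complex.norm_exp_ofReal_mul_I]; simp

lemma der_mult (i : Fin 2) :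
    der i (mult ι d) = II * (cst fun _ => 2 * Real.pi * d * (dir i).1) * mult ι d := by
  ext k x
  have h : HasFDerivAt (fun x : ℝ × ℝ => 2 * Real.pi * Complex.I * (d : ℂ) * (x.1 : ℂ)) _ x :=
    ((Complex.ofRealCLM.comp (ContinuousLinearMap.fst ℝ ℝ ℝ)).hasFDerivAt).const_mul
      (2 * Real.pi * Complex.I * (d : ℂ))
  rw [der_ev]
  have := h.cexp.fderiv
  change fderiv ℝ (fun x : ℝ × ℝ => Complex.exp _) x _ = _
  rw [this]
  simp [mult_ev]
  ring

lemma shift_pot_one (P : ι → FieldPair d) (i : Fin 2) : shift (1, 0) (pot P i) = pot P i := by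
  ext k x
  rw [shift_ev]
  have e : x + (1, 0) = (x.1 + 1, x.2) := by ext <;> simp
  fin_cases i <;> simp [pot, ofRe_ev, e, (P k).per1_a1 x, (P k).per1_a2 x]

lemma shift_sec_one (P : ι → FieldPair d) : shift (1, 0) (sec P) = sec P := by
  ext k x
  rw [shift_ev]
  have e : x + (1, 0) = (x.1 + 1, x.2) := by ext <;> simp
  rw [e]; exact (P k).per1_φ x

lemma shift_pot_two (P : ι → FieldPair d) (i : Fin 2) :
    shift (0, 1) (pot P i) = pot P i - cst fun _ => 2 * Real.pi * d * (dir i).1 := by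
  ext k x
  rw [shift_ev]
  have e : x + (0, 1) = (x.1, x.2 + 1) := by ext <;> simp
  fin_cases i <;> simp [pot, ofRe_ev, e, (P k).per2_a1 x, (P k).per2_a2 x, dir]

lemma shift_sec_two (P : ι → FieldPair d) : shift (0, 1) (sec P) = mult ι d * sec P := by
  ext k x
  rw [shift_ev]
  have e : x + (0, 1) = (x.1, x.2 + 1) := by ext <;> simp
  rw [e]; exact (P k).per2_φ x

lemma per_of_shift {f : Sm ι} (h1 : shift (1, 0) f = f) (h2 : shift (0, 1) f = f) (k : ι) :
    Per (f.1 k) := by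
  refine ⟨fun x => ?_, fun x => ?_⟩
  · have e : (x.1 + 1, x.2) = x + (1, 0) := by ext <;> simp
    rw [e, ← shift_ev, h1]
  · have e : (x.1, x.2 + 1) = x + (0, 1) := by ext <;> simp
    rw [e, ← shift_ev, h2]

lemma per_V (P : ι → FieldPair d) (n : ℕ) (k : ι) : Per ((V (pot P) 1 n (sec P)).1 k) := by
  refine per_of_shift ?_ ?_ k
  · rw [shift_V, shift_sec_one, funext (shift_pot_one P)]
  · rw [shift_V, shift_sec_two]
    refine V_gauge (fun i => ?_) mult_mul_cj _ _
    rw [der_mult, shift_pot_two]; ring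

lemma crv_pot (P : ι → FieldPair d) (k x) :
    (crv (pot P) 0 1).1 k x = (curv (P k).a1 (P k).a2 x : ℝ) := by
  rw [crv, sub_ev]
  simp only [pot, Matrix.cons_val_zero, Matrix.cons_val_one, der_ofRe]
  simp [curv, pd1, pd2, dir]

lemma shift_crv (P : ι → FieldPair d) :
    shift (1, 0) (crv (pot P) 0 1) = crv (pot P) 0 1 ∧
    shift (0, 1) (crv (pot P) 0 1) = crv (pot P) 0 1 := by
  constructor
  · simp only [crv, map_sub, ← der_shift, shift_pot_one]
  · simp only [crv, map_sub, ← der_shift, shift_pot_two, der_cst, sub_zero]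

/-- The external field as a constant family. -/
def fld (ι : Type) {F₀ : ℝ × ℝ → ℝ} (hF₀ : ExternalField d F₀) : Sm ι :=
  ofRe (fun _ => F₀) fun _ => hF₀.1

variable {α β : ℝ} {F₀ : ℝ × ℝ → ℝ}

lemma shift_fld (hF₀ : ExternalField d F₀) :
    shift (1, 0) (fld ι hF₀) = fld ι hF₀ ∧ shift (0, 1) (fld ι hF₀) = fld ι hF₀ := by
  constructor
  · ext k x
    have e : x + (1, 0) = (x.1 + 1, x.2) := by ext <;> simp
    rw [shift_ev, e]; simp [fld, ofRe_ev, hF₀.2.1 x]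
  · ext k x
    have e : x + (0, 1) = (x.1, x.2 + 1) := by ext <;> simp
    rw [shift_ev, e]; simp [fld, ofRe_ev, hF₀.2.2.1 x]

lemma Est.of_shift {a : Fin 2 → Sm ι} {f : Sm ι} (h : ∀ k k', f.1 k = f.1 k')
    (h1 : shift (1, 0) f = f) (h2 : shift (0, 1) f = f) (n : ℕ) : Est a 0 n 0 f := by
  have hb : ∀ f : Sm ι, (∀ k k', f.1 k = f.1 k') → shift (1, 0) f = f → shift (0, 1) f = f →
      ∃ C, ∀ k x, ‖f.1 k x‖ ≤ C := by
    intro f h h1 h2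
    rcases isEmpty_or_nonempty ι with hι | ⟨⟨k⟩⟩
    · exact ⟨0, fun k => hι.elim k⟩
    · obtain ⟨C, hC⟩ := (per_of_shift h1 h2 k).exists_bound (smooth f k).continuous
      exact ⟨C, fun k' x => by rw [h k' k]; exact hC x⟩
  induction n generalizing f with
  | zero => exact .of_bdd_zero (fun _ _ => le_rfl) (hb f h h1 h2)
  | succ n ih =>
    refine ⟨hb f h h1 h2, fun i => ?_⟩
    rw [cov_zero]
    refine ih (fun k k' => ?_) (by rw [← der_shift, h1]) (by rw [← der_shift, h2])
    funext x
    rw [der_ev, der_ev, h k k']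

lemma field_eq (hF₀ : ExternalField d F₀) (P : ι → FieldPair d) :
    crv (pot P) 0 1 - fld ι hF₀ = ofRe (fun k x => curv (P k).a1 (P k).a2 x - F₀ x)
      fun k => (P k).contDiff_curv.sub hF₀.1 := by
  ext k x
  rw [sub_ev, crv_pot, fld, ofRe_ev, ofRe_ev]; push_cast; rfl

/-- The Ginzburg–Landau equations for a family. -/
structure GLEq (α β : ℝ) (F₀ : Sm ι) (a : Fin 2 → Sm ι) (φ : Sm ι) : Prop where
  eq_one : der 1 (crv a 0 1 - F₀) =
    cst (fun _ => I / 2) * (cj φ * cov a 1 0 φ + cst (fun _ => -1) * (φ * cj (cov a 1 0 φ)))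
  eq_zero : der 0 (crv a 0 1 - F₀) =
    cst (fun _ => -I / 2) * (cj φ * cov a 1 1 φ + cst (fun _ => -1) * (φ * cj (cov a 1 1 φ)))
  eq_lap : lap a 1 φ = cst (fun _ => -(α : ℂ)) * φ + cst (fun _ => (β : ℂ)) * (φ * cj φ * φ)

lemma cov_pot_zero (P : ι → FieldPair d) (ψ : Sm ι) (k) :
    (cov (pot P) 1 0 ψ).1 k = D1 (P k).a1 (ψ.1 k) := by
  funext x; simp [cov, der_ev, D1, pd1, dir, pot, ofRe_ev]

lemma cov_pot_one (P : ι → FieldPair d) (ψ : Sm ι) (k) :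
    (cov (pot P) 1 1 ψ).1 k = D2 (P k).a2 (ψ.1 k) := by
  funext x; simp [cov, der_ev, D2, pd2, dir, pot, ofRe_ev]

lemma glEq_iff (hF₀ : ExternalField d F₀) (P : ι → FieldPair d) :
    GLEq α β (fld ι hF₀) (pot P) (sec P) ↔ ∀ k, IsGLSolution α β F₀ (P k) := by
  have him : ∀ u w : ℂ, starRingEnd ℂ u * w + -1 * (u * starRingEnd ℂ w) =
      2 * I * ((starRingEnd ℂ u * w).im : ℂ) := by
    intro u w
    apply Complex.ext <;> simp <;> ring
  have e1 : der 1 (crv (pot P) 0 1 - fld ι hF₀) = cst (fun _ => I / 2) *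
      (cj (sec P) * cov (pot P) 1 0 (sec P) +
        cst (fun _ => -1) * (sec P * cj (cov (pot P) 1 0 (sec P)))) ↔
      ∀ k x, pd2 (fun y => curv (P k).a1 (P k).a2 y - F₀ y) x
        + ((starRingEnd ℂ) ((P k).φ x) * D1 (P k).a1 (P k).φ x).im = 0 := by
    rw [Sm.ext_iff]
    refine forall_congr' fun k => forall_congr' fun x => ?_
    rw [field_eq, der_ofRe]
    simp only [mul_ev, add_ev, cj_ev, cst_ev, cov_pot_zero, him]
    rw [← mul_assoc]
    have : I / 2 * (2 * I) = -1 := by linear_combination I_mul_I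
    rw [this, neg_one_mul, ← Complex.ofReal_neg, Complex.ofReal_inj, ← sub_eq_zero, sub_neg_eq_add]
    rfl
  have e0 : der 0 (crv (pot P) 0 1 - fld ι hF₀) = cst (fun _ => -I / 2) *
      (cj (sec P) * cov (pot P) 1 1 (sec P) +
        cst (fun _ => -1) * (sec P * cj (cov (pot P) 1 1 (sec P)))) ↔
      ∀ k x, -pd1 (fun y => curv (P k).a1 (P k).a2 y - F₀ y) x
        + ((starRingEnd ℂ) ((P k).φ x) * D2 (P k).a2 (P k).φ x).im = 0 := by
    rw [Sm.ext_iff]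
    refine forall_congr' fun k => forall_congr' fun x => ?_
    rw [field_eq, der_ofRe]
    simp only [mul_ev, add_ev, cj_ev, cst_ev, cov_pot_one, him]
    rw [← mul_assoc]
    have : -I / 2 * (2 * I) = 1 := by linear_combination -I_mul_I
    rw [this, one_mul, Complex.ofReal_inj, neg_add_eq_zero]
    rfl
  have el : lap (pot P) 1 (sec P) = cst (fun _ => -(α : ℂ)) * sec P +
      cst (fun _ => (β : ℂ)) * (sec P * cj (sec P) * sec P) ↔
      ∀ k x, -(D1 (P k).a1 (D1 (P k).a1 (P k).φ) x + D2 (P k).a2 (D2 (P k).a2 (P k).φ) x)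
        = (α : ℂ) * (P k).φ x - (β : ℂ) * (‖(P k).φ x‖ : ℂ) ^ 2 * (P k).φ x := by
    rw [Sm.ext_iff]
    refine forall_congr' fun k => forall_congr' fun x => ?_
    have hs : (sec P).1 k = (P k).φ := rfl
    simp only [lap, Fin.sum_univ_two, add_ev, mul_ev, cst_ev, cj_ev, cov_pot_zero, cov_pot_one, hs]
    rw [← Complex.conj_mul', ← neg_inj (a := _ + _)]
    constructor <;> intro h <;> linear_combination h
  constructor
  · exact fun h k => ⟨e1.1 h.eq_one k, e0.1 h.eq_zero k, el.1 h.eq_lap k⟩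
  · exact fun h => ⟨e1.2 fun k => (h k).1, e0.2 fun k => (h k).2.1, el.2 fun k => (h k).2.2⟩

theorem isGL (hF₀ : ExternalField d F₀) (P : ι → FieldPair d)
    (hP : ∀ k, IsGLSolution α β F₀ (P k)) : IsGL α β (fld ι hF₀) (pot P) (sec P) := by
  have h := (glEq_iff (α := α) (β := β) hF₀ P).2 hP
  refine ⟨fun i => ?_, .of_shift (fun _ _ => rfl) (shift_fld hF₀).1 (shift_fld hF₀).2, per_V P,
    fun k M hM x => ?_, h.eq_one, h.eq_zero, h.eq_lap⟩
  · fin_cases i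
    exacts [cj_ofRe _ fun k => (P k).smooth_a1, cj_ofRe _ fun k => (P k).smooth_a2]
  · rw [field_eq] at hM ⊢
    simp only [der_ofRe, ofRe_ev, Complex.norm_real, Real.norm_eq_abs] at hM ⊢
    refine abs_le_of_integral_eq_zero ((P k).contDiff_curv.sub hF₀.1) ?_ ?_ hM x
    · have s1 : shift (1, 0) (crv (pot P) 0 1 - fld ι hF₀) = crv (pot P) 0 1 - fld ι hF₀ := by
        rw [map_sub, (shift_crv P).1, (shift_fld hF₀).1]
      have s2 : shift (0, 1) (crv (pot P) 0 1 - fld ι hF₀) = crv (pot P) 0 1 - fld ι hF₀ := by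
        rw [map_sub, (shift_crv P).2, (shift_fld hF₀).2]
      rw [field_eq] at s1 s2
      exact (per_of_shift s1 s2 k).comp Complex.re
    · rw [integral_sub, (P k).integral_curv, hF₀.2.2.2, sub_self]
      · exact (P k).contDiff_curv.continuous.continuousOn.integrableOn_compact isCompact_unitSquare
      · exact hF₀.1.continuous.continuousOn.integrableOn_compact isCompact_unitSquare

end Sm

lemma contDiff_primitive {f : ℝ × ℝ → ℝ} (hf : ContDiff ℝ (⊤ : ℕ∞) f) :
    ContDiff ℝ (⊤ : ℕ∞) fun x : ℝ × ℝ => ∫ t in (0 : ℝ)..x.2, f (x.1, t) := by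
  have e : (fun x : ℝ × ℝ => ∫ t in (0 : ℝ)..x.2, f (x.1, t)) =
      fun x : ℝ × ℝ => x.2 * ∫ t in (0 : ℝ)..1, f (x.1, x.2 * t) := by
    funext x
    have := intervalIntegral.smul_integral_comp_mul_left (a := 0) (b := 1) (fun t => f (x.1, t)) x.2
    rw [smul_eq_mul, mul_zero, mul_one] at this
    exact this.symm
  rw [e]
  refine contDiff_snd.mul ?_
  let χ : ContDiffBump (0 : ℝ) := ⟨1, 2, one_pos, one_lt_two⟩
  have key := contDiffOn_convolution_right_with_param_comp (𝕜 := ℝ) (n := (⊤ : ℕ∞))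
    (μ := (volume : Measure ℝ)) (ContinuousLinearMap.mul ℝ ℝ) (s := (Set.univ : Set (ℝ × ℝ)))
    (v := fun _ => (0 : ℝ)) contDiffOn_const (f := (Set.Ioc (0 : ℝ) 1).indicator fun _ => 1)
    (g := fun p t => χ t * f (p.1, p.2 * (-t))) (k := Metric.closedBall 0 2) isOpen_univ
    (isCompact_closedBall _ _) (fun p t _ ht => by
      have : χ t = 0 := χ.zero_of_le_dist (by
        rw [Metric.mem_closedBall, not_le] at ht; exact ht.le)
      rw [this, zero_mul])
    ((integrable_indicator_iff measurableSet_Ioc).2 (by simp)).locallyIntegrable (by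
      refine ContDiff.contDiffOn ?_
      refine (χ.contDiff.comp contDiff_snd).mul (hf.comp ?_)
      fun_prop)
  rw [contDiffOn_univ] at key
  refine Eq.mpr (congrArg (ContDiff ℝ (⊤ : ℕ∞)) (funext fun x => ?_)) key
  rw [convolution, intervalIntegral.integral_of_le zero_le_one, ← integral_indicator measurableSet_Ioc]
  congr 1
  funext t
  by_cases ht : t ∈ Set.Ioc (0 : ℝ) 1
  · have : χ (0 - t) = 1 := χ.one_of_mem_closedBall (by
      simp only [zero_sub, mem_closedBall_zero_iff, norm_neg, Real.norm_eq_abs]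
      rw [abs_of_pos ht.1]; exact ht.2)
    simp [ht]
    simp at this
    simp [this]
  · simp [ht]

lemma pd1_eq_deriv {f : ℝ × ℝ → ℝ} (hf : Differentiable ℝ f) (x : ℝ × ℝ) {L : ℝ}
    (h : HasDerivAt (fun s => f (s, x.2)) L x.1) : pd1 f x = L := by
  have := (hf x).hasFDerivAt.comp_hasDerivAt x.1
    ((hasDerivAt_id x.1).prodMk (hasDerivAt_const x.1 x.2))
  exact this.unique h

lemma pd2_eq_deriv {f : ℝ × ℝ → ℝ} (hf : Differentiable ℝ f) (x : ℝ × ℝ) {L : ℝ}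
    (h : HasDerivAt (fun s => f (x.1, s)) L x.2) : pd2 f x = L := by
  have := (hf x).hasFDerivAt.comp_hasDerivAt x.2
    ((hasDerivAt_const x.2 x.1).prodMk (hasDerivAt_id x.2))
  exact this.unique h

lemma contDiff_pd1 {E : Type*} [NormedAddCommGroup E] [NormedSpace ℝ E] {f : ℝ × ℝ → E}
    (hf : ContDiff ℝ (⊤ : ℕ∞) f) : ContDiff ℝ (⊤ : ℕ∞) (pd1 f) :=
  (hf.fderiv_right (m := (⊤ : ℕ∞)) (by simp)).clm_apply contDiff_const

lemma contDiff_pd2 {E : Type*} [NormedAddCommGroup E] [NormedSpace ℝ E] {f : ℝ × ℝ → E}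
    (hf : ContDiff ℝ (⊤ : ℕ∞) f) : ContDiff ℝ (⊤ : ℕ∞) (pd2 f) :=
  (hf.fderiv_right (m := (⊤ : ℕ∞)) (by simp)).clm_apply contDiff_const

/-- A real function that descends to the torus modulo `2π`. -/
structure IsPhase (χ : ℝ × ℝ → ℝ) : Prop where
  smooth : ContDiff ℝ (⊤ : ℕ∞) χ
  per_one : ∃ p : ℤ, ∀ x : ℝ × ℝ, χ (x.1 + 1, x.2) = χ x + p * (2 * Real.pi)
  per_two : ∃ p : ℤ, ∀ x : ℝ × ℝ, χ (x.1, x.2 + 1) = χ x + p * (2 * Real.pi)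

namespace IsPhase
variable {χ : ℝ × ℝ → ℝ}

lemma fderiv_one (h : IsPhase χ) (x : ℝ × ℝ) : fderiv ℝ χ (x.1 + 1, x.2) = fderiv ℝ χ x := by
  obtain ⟨p, hp⟩ := h.per_one
  have e : ∀ x : ℝ × ℝ, (x.1 + 1, x.2) = x + (1, 0) := fun x => by ext <;> simp
  simp only [e] at hp ⊢
  rw [← fderiv_comp_add_right, funext hp, fderiv_add_const]

lemma fderiv_two (h : IsPhase χ) (x : ℝ × ℝ) : fderiv ℝ χ (x.1, x.2 + 1) = fderiv ℝ χ x := by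
  obtain ⟨p, hp⟩ := h.per_two
  have e : ∀ x : ℝ × ℝ, (x.1, x.2 + 1) = x + (0, 1) := fun x => by ext <;> simp
  simp only [e] at hp ⊢
  rw [← fderiv_comp_add_right, funext hp, fderiv_add_const]

/-- The gauge transformation with a given phase. -/
def toFun (χ : ℝ × ℝ → ℝ) (x : ℝ × ℝ) : ℂ := Complex.exp (χ x * I)

lemma contDiff_toFun (h : IsPhase χ) : ContDiff ℝ (⊤ : ℕ∞) (toFun χ) :=
  ((Complex.ofRealCLM.contDiff.comp h.smooth).mul contDiff_const).cexp

lemma norm_toFun (χ : ℝ × ℝ → ℝ) (x : ℝ × ℝ) : ‖toFun χ x‖ = 1 := Complex.norm_exp_ofReal_mul_I _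

lemma toFun_add (p : ℤ) {x y : ℝ × ℝ} (h : χ y = χ x + p * (2 * Real.pi)) :
    toFun χ y = toFun χ x := by
  rw [toFun, toFun, h, Complex.exp_eq_exp_iff_exists_int]
  exact ⟨p, by push_cast; ring⟩

lemma per_toFun (h : IsPhase χ) : Per (toFun χ) := by
  obtain ⟨p, hp⟩ := h.per_one
  obtain ⟨q, hq⟩ := h.per_two
  exact ⟨fun x => toFun_add p (hp x), fun x => toFun_add q (hq x)⟩

lemma fderiv_toFun (h : IsPhase χ) (x v : ℝ × ℝ) :
    fderiv ℝ (toFun χ) x v = fderiv ℝ χ x v * I * toFun χ x := by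
  have h1 := (Complex.ofRealCLM.hasFDerivAt.comp x
    (h.smooth.differentiable (by simp) x).hasFDerivAt).mul_const' I
  have := congrArg (fun L => L v) h1.cexp.fderiv
  refine this.trans ?_
  simp [toFun]
  ring

lemma conj_toFun_mul (χ : ℝ × ℝ → ℝ) (x : ℝ × ℝ) :
    starRingEnd ℂ (toFun χ x) * toFun χ x = 1 := by
  rw [Complex.conj_mul', norm_toFun]; simp

lemma gauge_eq (h : IsPhase χ) (x v : ℝ × ℝ) :
    (I * starRingEnd ℂ (toFun χ x) * fderiv ℝ (toFun χ) x v).re = -fderiv ℝ χ x v := by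
  rw [h.fderiv_toFun]
  have : I * starRingEnd ℂ (toFun χ x) * (fderiv ℝ χ x v * I * toFun χ x) =
      ((-fderiv ℝ χ x v : ℝ) : ℂ) := by
    push_cast
    linear_combination (I * I * fderiv ℝ χ x v) * conj_toFun_mul χ x + fderiv ℝ χ x v * I_mul_I
  rw [this, Complex.ofReal_re]

lemma gaugeA1_eq (h : IsPhase χ) (a : ℝ × ℝ → ℝ) :
    gaugeA1 (toFun χ) a = fun x => a x - pd1 χ x := by
  funext x
  rw [gaugeA1, pd1, h.gauge_eq, ← sub_eq_add_neg]; rfl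

lemma gaugeA2_eq (h : IsPhase χ) (a : ℝ × ℝ → ℝ) :
    gaugeA2 (toFun χ) a = fun x => a x - pd2 χ x := by
  funext x
  rw [gaugeA2, pd2, h.gauge_eq, ← sub_eq_add_neg]; rfl

/-- The action of a gauge transformation on a field pair. -/
def act {d : ℤ} (h : IsPhase χ) (P : FieldPair d) : FieldPair d where
  a1 := fun x => P.a1 x - pd1 χ x
  a2 := fun x => P.a2 x - pd2 χ x
  φ := gaugePhi (toFun χ) P.φ
  smooth_a1 := P.smooth_a1.sub (contDiff_pd1 h.smooth)
  smooth_a2 := P.smooth_a2.sub (contDiff_pd2 h.smooth)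
  smooth_φ := h.contDiff_toFun.mul P.smooth_φ
  per1_a1 x := by rw [P.per1_a1, pd1, h.fderiv_one]; rfl
  per1_a2 x := by rw [P.per1_a2, pd2, h.fderiv_one]; rfl
  per1_φ x := by rw [gaugePhi, P.per1_φ, h.per_toFun.1]; rfl
  per2_a2 x := by rw [P.per2_a2, pd2, h.fderiv_two]; rfl
  per2_a1 x := by rw [P.per2_a1, pd1, h.fderiv_two, pd1]; ring
  per2_φ x := by rw [gaugePhi, P.per2_φ, h.per_toFun.2, gaugePhi]; ring

end IsPhase

namespace Sm
variable {ι : Type} {α β : ℝ} {F₀ : Sm ι} {a : Fin 2 → Sm ι} {φ : Sm ι}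

lemma GLEq.gauge (h : GLEq α β F₀ a φ) {a' : Fin 2 → Sm ι} {χ g : Sm ι}
    (ha : ∀ i, a' i = a i - der i χ) (hg : ∀ i, der i g = II * der i χ * g) (h1 : g * cj g = 1) :
    GLEq α β F₀ a' (g * φ) := by
  have hg' : ∀ i, der i g = II * (a i - a' i) * g := fun i => by rw [hg, ha]; ring
  have hc : crv a' 0 1 = crv a 0 1 := by
    simp only [crv, ha, map_sub, der_comm 0 1]; ring
  refine ⟨?_, ?_, ?_⟩
  · rw [hc, h.eq_one, cov_gauge hg', map_mul, map_mul]
    linear_combination (-cst (fun _ => I / 2) * (cj φ * cov a 1 0 φ +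
      cst (fun _ => -1) * (φ * cj (cov a 1 0 φ)))) * h1
  · rw [hc, h.eq_zero, cov_gauge hg', map_mul, map_mul]
    linear_combination (-cst (fun _ => -I / 2) * (cj φ * cov a 1 1 φ +
      cst (fun _ => -1) * (φ * cj (cov a 1 1 φ)))) * h1
  · have := h.eq_lap
    simp only [lap, Fin.sum_univ_two, cov_gauge hg', map_mul] at this ⊢
    linear_combination g * this - (cst (fun _ => (β : ℂ)) * (φ * cj φ * φ) * g) * h1

end Sm

lemma IsPhase.isGLSolution_act {d : ℤ} {χ : ℝ × ℝ → ℝ} (h : IsPhase χ) {α β : ℝ}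
    {F₀ : ℝ × ℝ → ℝ} (hF₀ : ExternalField d F₀) {P : FieldPair d} (hP : IsGLSolution α β F₀ P) :
    IsGLSolution α β F₀ (h.act P) := by
  have h1 := (Sm.glEq_iff (ι := Unit) (α := α) (β := β) hF₀ fun _ => P).2 fun _ => hP
  refine (Sm.glEq_iff (ι := Unit) (α := α) (β := β) hF₀ fun _ => h.act P).1 ?_ ()
  refine h1.gauge (χ := Sm.ofRe (fun _ => χ) fun _ => h.smooth)
    (g := ⟨fun _ => toFun χ, fun _ => h.contDiff_toFun⟩) (fun i => ?_) (fun i => ?_) ?_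
  · ext k x
    rw [Sm.sub_ev, Sm.der_ofRe]
    fin_cases i <;> simp [Sm.pot, Sm.ofRe_ev, act, pd1, pd2, Sm.dir]
  · ext k x
    rw [Sm.der_ev, Sm.mul_ev, Sm.mul_ev, Sm.der_ofRe, Sm.II_ev, mul_comm I]
    exact h.fderiv_toFun x _
  · ext k x
    rw [Sm.mul_ev, Sm.cj_ev, mul_comm]
    exact conj_toFun_mul χ x

lemma FieldPair.exists_axial_phase {d : ℤ} (P : FieldPair d) : ∃ (χ : ℝ × ℝ → ℝ) (h : IsPhase χ),
    (∀ x, pd2 (h.act P).a2 x = 0) ∧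
    (∃ c, |c| ≤ 2 * Real.pi ∧ ∀ s : ℝ, (h.act P).a1 (s, 0) = c) ∧
    |(h.act P).a2 (0, 0)| ≤ 2 * Real.pi := by
  have hc1 : Continuous P.a1 := P.smooth_a1.continuous
  have hc2 : Continuous P.a2 := P.smooth_a2.continuous
  set A : ℝ × ℝ → ℝ := fun x => ∫ t in (0 : ℝ)..x.2, P.a2 (x.1, t) with hA
  set B : ℝ → ℝ := fun s => ∫ t in (0 : ℝ)..s, P.a1 (t, 0) with hB
  have sA : ContDiff ℝ (⊤ : ℕ∞) A := contDiff_primitive P.smooth_a2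
  have sB : ContDiff ℝ (⊤ : ℕ∞) B :=
    (contDiff_primitive (f := fun x => P.a1 (x.2, 0)) (P.smooth_a1.comp (by fun_prop))).comp
      (contDiff_const.prodMk contDiff_id : ContDiff ℝ (⊤ : ℕ∞) fun s : ℝ => ((0 : ℝ), s))
  have hfloor : ∀ u : ℝ, |u - ⌊u / (2 * Real.pi)⌋ * (2 * Real.pi)| ≤ 2 * Real.pi := by
    intro u
    have h2 := Real.two_pi_pos
    have e : u = u / (2 * Real.pi) * (2 * Real.pi) := (div_mul_cancel₀ _ h2.ne').symm
    generalize u / (2 * Real.pi) = v at *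
    have f1 := Int.floor_le v
    have f2 := Int.lt_floor_add_one v
    rw [abs_le, e]; constructor <;> nlinarith
  set p : ℤ := ⌊B 1 / (2 * Real.pi)⌋ with hp
  set q : ℤ := ⌊A (0, 1) / (2 * Real.pi)⌋ with hq
  set χ : ℝ × ℝ → ℝ := fun x => A x - x.2 * A (x.1, 1) + B x.1 + (p * (2 * Real.pi) - B 1) * x.1 +
    q * (2 * Real.pi) * x.2 with hχ
  have sm : ContDiff ℝ (⊤ : ℕ∞) fun x : ℝ × ℝ => A (x.1, 1) := sA.comp (by fun_prop)
  have sBx : ContDiff ℝ (⊤ : ℕ∞) fun x : ℝ × ℝ => B x.1 := sB.comp contDiff_fst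
  have sχ : ContDiff ℝ (⊤ : ℕ∞) χ :=
    (((sA.sub (contDiff_snd.mul sm)).add sBx).add (contDiff_const.mul contDiff_fst)).add
      (contDiff_const.mul contDiff_snd)
  have perA : ∀ x : ℝ × ℝ, A (x.1 + 1, x.2) = A x := fun x => by
    simp only [hA]
    exact intervalIntegral.integral_congr fun t _ => P.per1_a2 (x.1, t)
  have perA2 : ∀ x : ℝ × ℝ, A (x.1, x.2 + 1) = A x + A (x.1, 1) := fun x => by
    have hper : Function.Periodic (fun t => P.a2 (x.1, t)) 1 := fun t => P.per2_a2 (x.1, t)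
    have hi : ∀ u v : ℝ, IntervalIntegrable (fun t => P.a2 (x.1, t)) volume u v := fun u v =>
      Continuous.intervalIntegrable (by fun_prop) _ _
    simp only [hA]
    have := hper.intervalIntegral_add_eq 0 x.2
    rw [zero_add] at this
    rw [this, intervalIntegral.integral_add_adjacent_intervals (hi _ _) (hi _ _)]
  have perB : ∀ s, B (s + 1) = B s + B 1 := fun s => by
    have hper : Function.Periodic (fun t => P.a1 (t, 0)) 1 := fun t => P.per1_a1 (t, 0)
    have hi : ∀ u v : ℝ, IntervalIntegrable (fun t => P.a1 (t, 0)) volume u v := fun u v =>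
      Continuous.intervalIntegrable (by fun_prop) _ _
    simp only [hB]
    have := hper.intervalIntegral_add_eq 0 s
    rw [zero_add] at this
    rw [this, intervalIntegral.integral_add_adjacent_intervals (hi _ _) (hi _ _)]
  have h : IsPhase χ := by
    refine ⟨sχ, ⟨p, fun x => ?_⟩, ⟨q, fun x => ?_⟩⟩
    · simp only [hχ, perA, perB, perA (x.1, 1)]
      ring
    · simp only [hχ, perA2]
      ring
  have dχ : Differentiable ℝ χ := sχ.differentiable (by simp)
  have e2 : ∀ x, (h.act P).a2 x = A (x.1, 1) - q * (2 * Real.pi) := by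
    intro x
    have hd : HasDerivAt (fun t => A (x.1, t)) (P.a2 x) x.2 := by
      have hcont : Continuous fun t => P.a2 (x.1, t) := by fun_prop
      exact hcont.integral_hasStrictDerivAt 0 x.2 |>.hasDerivAt
    have : pd2 χ x = P.a2 x - 1 * A (x.1, 1) + q * (2 * Real.pi) * 1 := by
      refine pd2_eq_deriv dχ x ?_
      exact (((hd.sub ((hasDerivAt_id x.2).mul_const (A (x.1, 1)))).add_const (B x.1)).add_const
        ((p * (2 * Real.pi) - B 1) * x.1)).add ((hasDerivAt_id x.2).const_mul (q * (2 * Real.pi)))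
    change P.a2 x - pd2 χ x = _
    rw [this]; ring
  refine ⟨χ, h, fun x => ?_, ⟨B 1 - p * (2 * Real.pi), hfloor _, fun s => ?_⟩, ?_⟩
  · rw [funext e2]
    refine pd2_eq_deriv ((sm.sub contDiff_const).differentiable (by simp)) x ?_
    exact hasDerivAt_const x.2 (A (x.1, 1) - q * (2 * Real.pi))
  · have hd : HasDerivAt B (P.a1 (s, 0)) s := by
      have hcont : Continuous fun t => P.a1 (t, 0) := by fun_prop
      exact hcont.integral_hasStrictDerivAt 0 s |>.hasDerivAt
    have e0 : ∀ t, χ (t, 0) = B t + (p * (2 * Real.pi) - B 1) * t := fun t => by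
      have : A (t, 0) = 0 := intervalIntegral.integral_same
      simp only [hχ, this]; ring
    have : pd1 χ (s, 0) = P.a1 (s, 0) + (p * (2 * Real.pi) - B 1) * 1 := by
      refine pd1_eq_deriv dχ (s, 0) ?_
      simp only [e0]
      exact hd.add ((hasDerivAt_id s).const_mul _)
    change P.a1 (s, 0) - pd1 χ (s, 0) = _
    rw [this]; ring
  · rw [e2]; exact hfloor _

namespace Sm

variable {ι : Type} {a : Fin 2 → Sm ι}

/-- Partial derivatives of order at most `n` are bounded on bounded sets, uniformly over the
family. -/
def LB : ℕ → Sm ι → Prop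
  | 0, f => ∀ R : ℝ, ∃ C, ∀ k x, ‖x‖ ≤ R → ‖f.1 k x‖ ≤ C
  | n + 1, f => (∀ R : ℝ, ∃ C, ∀ k x, ‖x‖ ≤ R → ‖f.1 k x‖ ≤ C) ∧ ∀ i, LB n (der i f)

lemma LB.to_zero {n : ℕ} {f : Sm ι} (h : LB n f) : LB 0 f := by
  cases n with
  | zero => exact h
  | succ n => exact h.1

lemma LB.of_succ {n : ℕ} {f : Sm ι} (h : LB (n + 1) f) : LB n f := by
  induction n generalizing f with
  | zero => exact h.1
  | succ n ih => exact ⟨h.1, fun i => ih (h.2 i)⟩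

lemma LB.add_zero {f g : Sm ι} (hf : LB 0 f) (hg : LB 0 g) : LB 0 (f + g) := fun R => by
  obtain ⟨C, hC⟩ := hf R
  obtain ⟨C', hC'⟩ := hg R
  exact ⟨C + C', fun k x hx => (norm_add_le _ _).trans (add_le_add (hC k x hx) (hC' k x hx))⟩

lemma LB.mul_zero {f g : Sm ι} (hf : LB 0 f) (hg : LB 0 g) : LB 0 (f * g) := fun R => by
  obtain ⟨C, hC⟩ := hf R
  obtain ⟨C', hC'⟩ := hg R
  refine ⟨C * C', fun k x hx => ?_⟩
  rw [mul_ev, norm_mul]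
  exact mul_le_mul (hC k x hx) (hC' k x hx) (norm_nonneg _) ((norm_nonneg _).trans (hC k x hx))

lemma LB.add {n : ℕ} {f g : Sm ι} (hf : LB n f) (hg : LB n g) : LB n (f + g) := by
  induction n generalizing f g with
  | zero => exact hf.add_zero hg
  | succ n ih =>
    refine ⟨hf.to_zero.add_zero hg.to_zero, fun i => ?_⟩
    rw [map_add]
    exact ih (hf.2 i) (hg.2 i)

lemma LB.mul {n : ℕ} {f g : Sm ι} (hf : LB n f) (hg : LB n g) : LB n (f * g) := by
  induction n generalizing f g with
  | zero => exact hf.mul_zero hg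
  | succ n ih =>
    refine ⟨hf.to_zero.mul_zero hg.to_zero, fun i => ?_⟩
    rw [der_mul]
    exact (ih (hf.2 i) hg.of_succ).add (ih hf.of_succ (hg.2 i))

lemma LB.const (c : ℂ) (n : ℕ) : LB n (cst fun _ : ι => c) := by
  have h (c : ℂ) : LB 0 (cst fun _ : ι => c) := fun R => ⟨‖c‖, fun k x _ => le_rfl⟩
  induction n generalizing c with
  | zero => exact h c
  | succ n ih => exact ⟨h c, fun i => by rw [der_cst]; exact ih 0⟩

lemma LB.sub {n : ℕ} {f g : Sm ι} (hf : LB n f) (hg : LB n g) : LB n (f - g) := by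
  have : f - g = f + cst (fun _ => -1) * g := by ext k x; simp [sub_eq_add_neg]
  rw [this]
  exact hf.add ((LB.const _ n).mul hg)

lemma Est.lb_curvature {n : ℕ} {f : Sm ι} (h : Est a 0 n 0 f) : LB n f := by
  induction n generalizing f with
  | zero =>
    obtain ⟨C, hC⟩ := h.bdd
    exact fun R => ⟨C, fun k x _ => hC k x⟩
  | succ n ih =>
    obtain ⟨C, hC⟩ := h.bdd
    refine ⟨fun R => ⟨C, fun k x _ => hC k x⟩, fun i => ?_⟩
    rw [← cov_zero (a := a)]
    exact ih (h.2 i)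

lemma Est.lb (ha : ∀ n i, LB n (a i)) {n : ℕ} {q : ℤ} {ψ : Sm ι} (h : Est a 0 n q ψ) :
    LB n ψ := by
  induction n generalizing ψ with
  | zero =>
    obtain ⟨C, hC⟩ := h.bdd
    exact fun R => ⟨C, fun k x _ => hC k x⟩
  | succ n ih =>
    obtain ⟨C, hC⟩ := h.bdd
    refine ⟨fun R => ⟨C, fun k x _ => hC k x⟩, fun i => ?_⟩
    have : der i ψ = cov a q i ψ - II * (q : Sm ι) * a i * ψ := by rw [cov]; ring
    rw [this]
    exact (ih (h.2 i)).sub ((((LB.const _ n).mul (LB.const (q : ℂ) n)).mul (ha n i)).mul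
      (ih (h.of_succ fun _ _ => le_rfl)))

lemma norm_sub_le (f : Sm ι) (k : ι) (i : Fin 2) {x : ℝ × ℝ} {s C : ℝ}
    (h : ∀ t ∈ Set.Ico (0 : ℝ) 1, ‖(der i f).1 k (x + (t * s) • dir i)‖ ≤ C) :
    ‖f.1 k (x + s • dir i) - f.1 k x‖ ≤ |s| * C := by
  have key : ∀ t : ℝ, HasDerivAt (fun t : ℝ => f.1 k (x + (t * s) • dir i))
      ((s : ℂ) * (der i f).1 k (x + (t * s) • dir i)) t := fun t => by
    have h1 : HasDerivAt (fun t : ℝ => x + (t * s) • dir i) ((1 * s) • dir i) t :=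
      (((hasDerivAt_id t).mul_const s).smul_const (dir i)).const_add x
    have := (diff f k _).hasFDerivAt.comp_hasDerivAt t h1
    rw [one_mul, map_smul, Complex.real_smul] at this
    exact this
  have := norm_image_sub_le_of_norm_deriv_le_segment_01' (C := |s| * C)
    (fun t _ => (key t).hasDerivWithinAt) fun t ht => by
      rw [norm_mul, Complex.norm_real, Real.norm_eq_abs]
      gcongr
      exact h t ht
  simpa using this

lemma LB.of_der_zero {f : Sm ι} (h : LB 0 (der 0 f))
    (h0 : ∀ R : ℝ, ∃ C, ∀ k (s : ℝ), |s| ≤ R → ‖f.1 k (0, s)‖ ≤ C) : LB 0 f := fun R => by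
  obtain ⟨C, hC⟩ := h R
  obtain ⟨C', hC'⟩ := h0 R
  refine ⟨C' + R * C, fun k x hx => ?_⟩
  rw [Prod.norm_def, max_le_iff] at hx
  have hR : 0 ≤ R := (norm_nonneg _).trans hx.1
  have hC0 : 0 ≤ C := (norm_nonneg _).trans (hC k 0 (by simpa using hR))
  have e : x = (0, x.2) + x.1 • dir 0 := by ext <;> simp [dir]
  have h1 := norm_sub_le f k 0 (x := (0, x.2)) (s := x.1) (C := C) fun t ht => hC k _ (by
    simp only [dir, Matrix.cons_val_zero, Prod.smul_mk, smul_eq_mul, Prod.mk_add_mk, Prod.norm_def,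
      max_le_iff, mul_one, MulZeroClass.mul_zero, _root_.zero_add, _root_.add_zero, norm_mul]
    refine ⟨?_, hx.2⟩
    rw [Real.norm_of_nonneg ht.1]
    exact (mul_le_of_le_one_left (norm_nonneg _) ht.2.le).trans hx.1)
  rw [← e] at h1
  have h2 := hC' k x.2 hx.2
  have h3 : |x.1| * C ≤ R * C := by gcongr; exact hx.1
  have := norm_le_norm_add_norm_sub' (f.1 k x) (f.1 k (0, x.2))
  linarith

lemma LB.of_der_one {f : Sm ι} (h : LB 0 (der 1 f))
    (h0 : ∀ R : ℝ, ∃ C, ∀ k (s : ℝ), |s| ≤ R → ‖f.1 k (s, 0)‖ ≤ C) : LB 0 f := fun R => by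
  obtain ⟨C, hC⟩ := h R
  obtain ⟨C', hC'⟩ := h0 R
  refine ⟨C' + R * C, fun k x hx => ?_⟩
  rw [Prod.norm_def, max_le_iff] at hx
  have hR : 0 ≤ R := (norm_nonneg _).trans hx.1
  have hC0 : 0 ≤ C := (norm_nonneg _).trans (hC k 0 (by simpa using hR))
  have e : x = (x.1, 0) + x.2 • dir 1 := by ext <;> simp [dir]
  have h1 := norm_sub_le f k 1 (x := (x.1, 0)) (s := x.2) (C := C) fun t ht => hC k _ (by
    simp only [dir, Matrix.cons_val_one, Matrix.cons_val_zero, Prod.smul_mk, smul_eq_mul,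
      Prod.mk_add_mk, Prod.norm_def,
      max_le_iff, mul_one, MulZeroClass.mul_zero, _root_.zero_add, _root_.add_zero, norm_mul]
    refine ⟨hx.1, ?_⟩
    rw [Real.norm_of_nonneg ht.1]
    exact (mul_le_of_le_one_left (norm_nonneg _) ht.2.le).trans hx.2)
  rw [← e] at h1
  have h2 := hC' k x.1 hx.1
  have h3 : |x.2| * C ≤ R * C := by gcongr; exact hx.2
  have := norm_le_norm_add_norm_sub' (f.1 k x) (f.1 k (x.1, 0))
  linarith

lemma eq_axis {c : Sm ι} (h : der 1 c = 0) (k : ι) (x : ℝ × ℝ) : c.1 k x = c.1 k (x.1, 0) := by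
  have e : x = (x.1, 0) + x.2 • dir 1 := by ext <;> simp [dir]
  have h1 := norm_sub_le c k 1 (x := (x.1, 0)) (s := x.2) (C := 0) fun t _ => by
    rw [h, zero_ev, norm_zero]
  rw [← e, MulZeroClass.mul_zero] at h1
  exact sub_eq_zero.1 (norm_le_zero_iff.1 h1)

/-- Local bounds for the derivative of a potential in axial gauge. -/
lemma LB.der_axial {b c : Sm ι} {κ : ι → ℂ} {K : ℝ} (hF : LB 0 (der 0 c - der 1 b))
    (hc : der 1 c = 0) (hκ : ∀ k, ‖κ k‖ ≤ K)
    (hb : ∀ k (s : ℝ), b.1 k (s, 1) - b.1 k (s, 0) = κ k) : LB 0 (der 0 c) := fun R => by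
  obtain ⟨C, hC⟩ := hF (max R 1)
  refine ⟨K + C, fun k x hx => ?_⟩
  have hc' : der 1 (der 0 c) = 0 := by rw [der_comm, hc, map_zero]
  set D := (der 0 c).1 k x with hD
  let u : Sm ι := ⟨fun _ x => x.2, fun _ => Complex.ofRealCLM.contDiff.comp contDiff_snd⟩
  have hu : der 1 u = 1 := by
    ext k x
    have : HasFDerivAt (u.1 k) (Complex.ofRealCLM.comp (ContinuousLinearMap.snd ℝ ℝ ℝ)) x :=
      (Complex.ofRealCLM.comp (ContinuousLinearMap.snd ℝ ℝ ℝ)).hasFDerivAt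
    rw [der_ev, this.fderiv]
    simp [dir]
  have e : (x.1, 0) + (1 : ℝ) • dir 1 = (x.1, 1) := by simp [dir]
  have h1 := norm_sub_le (b - cst (fun _ => D) * u) k 1 (x := (x.1, 0)) (s := 1) (C := C)
    fun t ht => by
      have e1 : (der 1 (b - cst (fun _ => D) * u)).1 k ((x.1, 0) + (t * 1) • dir 1) =
          -(der 0 c - der 1 b).1 k ((x.1, 0) + (t * 1) • dir 1) := by
        rw [map_sub, der_mul, hu, der_cst, sub_ev, sub_ev, eq_axis hc']
        simp [dir, hD, eq_axis hc' k x]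
      rw [e1, norm_neg]
      refine hC k _ ?_
      rw [Prod.norm_def, max_le_iff] at hx
      simp only [dir, Matrix.cons_val_one, Matrix.cons_val_zero, Prod.smul_mk, smul_eq_mul,
        Prod.mk_add_mk, Prod.norm_def,
        max_le_iff, mul_one, MulZeroClass.mul_zero, _root_.zero_add, _root_.add_zero]
      refine ⟨hx.1.trans (le_max_left _ _), ?_⟩
      rw [Real.norm_of_nonneg ht.1]
      exact ht.2.le.trans (le_max_right _ _)
  rw [e, abs_one, one_mul] at h1
  have e2 : (b - cst (fun _ => D) * u).1 k (x.1, 1) - (b - cst (fun _ => D) * u).1 k (x.1, 0) =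
      κ k - D := by
    simp only [sub_ev, mul_ev, cst_ev, ← hb k x.1, u]
    push_cast; ring
  rw [e2] at h1
  have := norm_le_norm_add_norm_sub (κ k) D
  linarith [hκ k]

lemma LB.axial {n : ℕ} {b c : Sm ι} {κ κ' : ι → ℂ} {K : ℝ} (hF : LB n (der 0 c - der 1 b))
    (hc : der 1 c = 0) (hκ : ∀ k, ‖κ k‖ ≤ K) (hκ' : ∀ k, ‖κ' k‖ ≤ K)
    (hb : ∀ k (s : ℝ), b.1 k (s, 1) - b.1 k (s, 0) = κ k)
    (hb0 : ∀ k (s : ℝ), b.1 k (s, 0) = κ' k) (hc0 : ∃ M, ∀ k, ‖c.1 k (0, 0)‖ ≤ M) :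
    LB n b ∧ LB n c := by
  induction n generalizing b c κ κ' K with
  | zero =>
    have h0 := LB.der_axial hF hc hκ hb
    have h1 : LB 0 (der 1 b) := by
      have : der 1 b = der 0 c - (der 0 c - der 1 b) := by ring
      rw [this]
      exact h0.sub hF
    refine ⟨h1.of_der_one fun R => ⟨K, fun k s _ => by rw [hb0]; exact hκ' k⟩, ?_⟩
    obtain ⟨M, hM⟩ := hc0
    exact h0.of_der_zero fun R => ⟨M, fun k s _ => by rw [eq_axis hc]; exact hM k⟩
  | succ n ih =>
    obtain ⟨b0, c0⟩ := ih hF.of_succ hc hκ hκ' hb hb0 hc0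
    have hd : ∀ (f : Sm ι) k (s t : ℝ), HasDerivAt (fun s => f.1 k (s, t)) ((der 0 f).1 k (s, t)) s :=
      fun f k s t => (diff f k _).hasFDerivAt.comp_hasDerivAt s
        ((hasDerivAt_id s).prodMk (hasDerivAt_const s t))
    have hcd := LB.der_axial hF.to_zero hc hκ hb
    obtain ⟨b1, c1⟩ := ih (b := der 0 b) (c := der 0 c) (κ := 0) (κ' := 0) (K := 0)
      (by rw [der_comm 1 0, ← map_sub]; exact hF.2 0)
      (by rw [der_comm, hc, map_zero]) (by simp) (by simp)
      (fun k s => by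
        have h := ((hd b k s 1).sub (hd b k s 0)).congr_of_eventuallyEq
          (f₁ := fun _ => κ k) (.of_forall fun s => (hb k s).symm)
        exact h.unique (hasDerivAt_const _ _))
      (fun k s => by
        have h := (hd b k s 0).congr_of_eventuallyEq
          (f₁ := fun _ => κ' k) (.of_forall fun s => (hb0 k s).symm)
        exact h.unique (hasDerivAt_const _ _))
      (by
        obtain ⟨C, hC⟩ := hcd 0
        exact ⟨C, fun k => hC k _ (by simp)⟩)
    have b2 : LB n (der 1 b) := by
      have : der 1 b = der 0 c - (der 0 c - der 1 b) := by ring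
      rw [this]
      exact c1.sub hF.of_succ
    refine ⟨⟨b0.to_zero, fun i => ?_⟩, c0.to_zero, fun i => ?_⟩
    · fin_cases i
      · exact b1
      · exact b2
    · fin_cases i
      · exact c1
      · change LB n (der 1 c)
        rw [hc]
        exact LB.const 0 n

end Sm

lemma equicontinuous_of_locally_lipschitz {κ : Type*} (F : κ → ℝ × ℝ → ℂ) (L : ℕ → ℝ)
    (h : ∀ i, ∀ n : ℕ, ∀ x y, ‖x‖ ≤ n → ‖y‖ ≤ n → ‖F i x - F i y‖ ≤ L n * ‖x - y‖) :
    Equicontinuous F := fun x => by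
  obtain ⟨n, hn⟩ := exists_nat_gt ‖x‖
  refine Metric.equicontinuousAt_of_continuity_modulus (fun y => L n * ‖x - y‖) ?_ F ?_
  · have : Continuous fun y => L n * ‖x - y‖ := by fun_prop
    simpa using this.tendsto x
  · filter_upwards [continuous_norm.continuousAt.eventually_lt continuousAt_const hn] with y hy i
    rw [dist_eq_norm]
    exact h i n x y hn.le hy.le

lemma isCompact_locally_lipschitz (M : ℝ × ℝ → ℝ) (L : ℕ → ℝ) :
    IsCompact {f : C(ℝ × ℝ, ℂ) | (∀ x, ‖f x‖ ≤ M x) ∧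
      ∀ n : ℕ, ∀ x y, ‖x‖ ≤ n → ‖y‖ ≤ n → ‖f x - f y‖ ≤ L n * ‖x - y‖} := by
  set T : Set (ℝ × ℝ → ℂ) := {f | (∀ x, ‖f x‖ ≤ M x) ∧
      ∀ n : ℕ, ∀ x y, ‖x‖ ≤ n → ‖y‖ ≤ n → ‖f x - f y‖ ≤ L n * ‖x - y‖} with hT
  refine ArzelaAscoli.isCompact_of_equicontinuous _ ?_
    (equicontinuous_of_locally_lipschitz _ L fun f => f.2.2)
  have e : ContinuousMap.toFun '' {f : C(ℝ × ℝ, ℂ) | (∀ x, ‖f x‖ ≤ M x) ∧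
      ∀ n : ℕ, ∀ x y, ‖x‖ ≤ n → ‖y‖ ≤ n → ‖f x - f y‖ ≤ L n * ‖x - y‖} = T := by
    ext f
    refine ⟨?_, fun hf => ?_⟩
    · rintro ⟨g, hg, rfl⟩
      exact hg
    · have := (equicontinuous_of_locally_lipschitz (fun _ : Unit => f) L fun _ => hf.2).continuous ()
      exact ⟨⟨f, this⟩, hf, rfl⟩
  rw [e]
  have hcl : IsClosed T := by
    simp only [hT, Set.ofPred_and, Set.ofPred_forall]
    refine (isClosed_iInter fun x => ?_).inter (isClosed_iInter fun n => isClosed_iInter fun x =>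
      isClosed_iInter fun y => isClosed_iInter fun _ => isClosed_iInter fun _ => ?_)
    · exact isClosed_le (by fun_prop) (by fun_prop)
    · exact isClosed_le (by fun_prop) (by fun_prop)
  refine (isCompact_univ_pi fun x => isCompact_closedBall (0 : ℂ) (M x)).of_isClosed_subset hcl ?_
  intro f hf x _
  simpa using hf.1 x

/-- The real linear map with given partial derivatives. -/
def ofPartials : ℂ × ℂ →L[ℝ] (ℝ × ℝ →L[ℝ] ℂ) :=
  (ContinuousLinearMap.smulRightL ℝ (ℝ × ℝ) ℂ (ContinuousLinearMap.fst ℝ ℝ ℝ)).comp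
      (ContinuousLinearMap.fst ℝ ℂ ℂ) +
    (ContinuousLinearMap.smulRightL ℝ (ℝ × ℝ) ℂ (ContinuousLinearMap.snd ℝ ℝ ℝ)).comp
      (ContinuousLinearMap.snd ℝ ℂ ℂ)

lemma ofPartials_apply (p : ℂ × ℂ) (v : ℝ × ℝ) : ofPartials p v = v.1 * p.1 + v.2 * p.2 := by
  simp [ofPartials]

namespace Sm

variable {ι : Type}

lemma fderiv_eq (f : Sm ι) (k : ι) (x : ℝ × ℝ) :
    fderiv ℝ (f.1 k) x = ofPartials ((der 0 f).1 k x, (der 1 f).1 k x) := by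
  ext1
  · ext
    simp [ofPartials_apply, der_ev, dir]
  · ext
    simp [ofPartials_apply, der_ev, dir]

lemma LB.lipschitz {f : Sm ι} (h : LB 1 f) (R : ℝ) :
    ∃ L, ∀ k x y, ‖x‖ ≤ R → ‖y‖ ≤ R → ‖f.1 k x - f.1 k y‖ ≤ L * ‖x - y‖ := by
  obtain ⟨C, hC⟩ := h.2 0 R
  obtain ⟨C', hC'⟩ := h.2 1 R
  refine ⟨‖ofPartials‖ * max C C', fun k x y hx hy => ?_⟩
  refine (convex_closedBall (0 : ℝ × ℝ) R).norm_image_sub_le_of_norm_fderiv_le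
    (fun z _ => diff f k z) (fun z hz => ?_) (by simpa using hy) (by simpa using hx)
  rw [mem_closedBall_zero_iff] at hz
  rw [fderiv_eq]
  refine (ofPartials.le_opNorm _).trans ?_
  gcongr
  rw [Prod.norm_def]
  exact max_le_max (hC k z hz) (hC' k z hz)

/-- Iterated partial derivatives. -/
def derL : List (Fin 2) → Sm ι → Sm ι
  | [], f => f
  | i :: w, f => der i (derL w f)

lemma LB.derL {f : Sm ι} (h : ∀ n, LB n f) (w : List (Fin 2)) (n : ℕ) : LB n (derL w f) := by
  induction w generalizing n with
  | nil => exact h n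
  | cons i w ih => exact (ih (n + 1)).2 i

/-- Pointwise convergence of all partial derivatives of order at most `n` along a sequence. -/
def Conv (l : ℕ → ι) : ℕ → Sm ι → Sm Unit → Prop
  | 0, f, g => ∀ x, Filter.Tendsto (fun m => f.1 (l m) x) Filter.atTop (nhds (g.1 () x))
  | n + 1, f, g => (∀ x, Filter.Tendsto (fun m => f.1 (l m) x) Filter.atTop (nhds (g.1 () x))) ∧
      ∀ i, Conv l n (der i f) (der i g)

theorem exists_conv {J : Type} [Countable J] (f : J → Sm ℕ) (h : ∀ j n, LB n (f j)) :
    ∃ l : ℕ → ℕ, StrictMono l ∧ ∃ g : J → Sm Unit, ∀ j n, Conv l n (f j) (g j) := by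
  let F : ℕ → J × List (Fin 2) → C(ℝ × ℝ, ℂ) := fun m p =>
    ⟨(derL p.2 (f p.1)).1 m, (smooth _ m).continuous⟩
  have hM : ∀ (p : J × List (Fin 2)) (x : ℝ × ℝ), ∃ C, ∀ k, ‖(derL p.2 (f p.1)).1 k x‖ ≤ C :=
    fun p x => by
      obtain ⟨C, hC⟩ := LB.derL (h p.1) p.2 0 ‖x‖
      exact ⟨C, fun k => hC k x le_rfl⟩
  choose M hM using hM
  choose L hL using fun (p : J × List (Fin 2)) (n : ℕ) => (LB.derL (h p.1) p.2 1).lipschitz n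
  obtain ⟨G, -, l, hl, hG⟩ := (isCompact_univ_pi fun p =>
    isCompact_locally_lipschitz (M p) (L p)).tendsto_subseq (x := F) fun m p _ =>
      ⟨fun x => hM p x m, fun n x y hx hy => hL p n m x y hx hy⟩
  rw [tendsto_pi_nhds] at hG
  have hlu : ∀ p, TendstoLocallyUniformlyOn (fun m => (derL p.2 (f p.1)).1 (l m)) (G p)
      Filter.atTop Set.univ := fun p => by
    rw [tendstoLocallyUniformlyOn_univ]
    exact ContinuousMap.tendsto_iff_tendstoLocallyUniformly.1 (hG p)
  have hpt : ∀ p x, Filter.Tendsto (fun m => (derL p.2 (f p.1)).1 (l m) x) Filter.atTop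
      (nhds (G p x)) := fun p x => (hlu p).tendsto_at (Set.mem_univ x)
  have hd : ∀ j w x, HasFDerivAt (G (j, w))
      (ofPartials (G (j, 0 :: w) x, G (j, 1 :: w) x)) x := fun j w x => by
    refine hasFDerivAt_of_tendstoLocallyUniformlyOn (l := Filter.atTop) isOpen_univ
      (ofPartials.uniformContinuous.comp_tendstoLocallyUniformlyOn
        ((hlu (j, 0 :: w)).prodMk (hlu (j, 1 :: w))))
      (f := fun m => (derL w (f j)).1 (l m)) (fun m y _ => ?_) (fun y _ => hpt (j, w) y)
      (Set.mem_univ x)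
    have := (diff (derL w (f j)) (l m) y).hasFDerivAt
    rwa [fderiv_eq] at this
  have hs : ∀ (n : ℕ) j w, ContDiff ℝ n (G (j, w)) := by
    intro n
    induction n with
    | zero => exact fun j w => contDiff_zero.2 (G (j, w)).continuous
    | succ n ih =>
      intro j w
      push_cast
      exact contDiff_succ_iff_hasFDerivAt.2
        ⟨_, ofPartials.contDiff.comp ((ih j (0 :: w)).prodMk (ih j (1 :: w))), hd j w⟩
  let g : J → Sm Unit := fun j => ⟨fun _ => G (j, []), fun _ => contDiff_infty.2 fun n => hs n j []⟩
  have hg : ∀ j w, (derL w (g j)).1 () = G (j, w) := by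
    intro j w
    induction w with
    | nil => rfl
    | cons i w ih =>
      funext x
      rw [derL, der_ev, ih, (hd j w x).fderiv, ofPartials_apply]
      fin_cases i <;> simp [dir]
  have key : ∀ n j w, Conv l n (derL w (f j)) (derL w (g j)) := by
    intro n
    induction n with
    | zero => exact fun j w x => by rw [hg]; exact hpt (j, w) x
    | succ n ih =>
      exact fun j w => ⟨fun x => by rw [hg]; exact hpt (j, w) x, fun i => ih j (i :: w)⟩
  exact ⟨l, hl, g, fun j n => key n j []⟩

variable {l : ℕ → ι} {n : ℕ} {f f' : Sm ι} {g g' : Sm Unit}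

lemma Conv.tendsto (h : Conv l n f g) (x : ℝ × ℝ) :
    Filter.Tendsto (fun m => f.1 (l m) x) Filter.atTop (nhds (g.1 () x)) := by
  cases n with
  | zero => exact h x
  | succ n => exact h.1 x

lemma Conv.unique (h : Conv l n f g) (h' : Conv l n f g') : g = g' := by
  ext k x
  exact tendsto_nhds_unique (h.tendsto x) (h'.tendsto x)

lemma Conv.of_succ (h : Conv l (n + 1) f g) : Conv l n f g := by
  induction n generalizing f g with
  | zero => exact h.1
  | succ n ih => exact ⟨h.1, fun i => ih (h.2 i)⟩

lemma Conv.add (h : Conv l n f g) (h' : Conv l n f' g') : Conv l n (f + f') (g + g') := by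
  induction n generalizing f g f' g' with
  | zero => exact fun x => (h.tendsto x).add (h'.tendsto x)
  | succ n ih =>
    refine ⟨fun x => (h.tendsto x).add (h'.tendsto x), fun i => ?_⟩
    rw [map_add, map_add]
    exact ih (h.2 i) (h'.2 i)

lemma Conv.mul (h : Conv l n f g) (h' : Conv l n f' g') : Conv l n (f * f') (g * g') := by
  induction n generalizing f g f' g' with
  | zero => exact fun x => (h.tendsto x).mul (h'.tendsto x)
  | succ n ih =>
    refine ⟨fun x => (h.tendsto x).mul (h'.tendsto x), fun i => ?_⟩
    rw [der_mul, der_mul]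
    exact (ih (h.2 i) h'.of_succ).add (ih h.of_succ (h'.2 i))

lemma Conv.const (c : ℂ) : Conv l n (cst fun _ => c) (cst fun _ => c) := by
  induction n generalizing c with
  | zero => exact fun x => tendsto_const_nhds
  | succ n ih =>
    refine ⟨fun x => tendsto_const_nhds, fun i => ?_⟩
    rw [der_cst, der_cst]
    exact ih 0

lemma Conv.neg (h : Conv l n f g) : Conv l n (-f) (-g) := by
  have := (Conv.const (l := l) (n := n) (-1)).mul h
  rwa [show cst (fun _ : ι => (-1 : ℂ)) * f = -f by ext; simp,
    show cst (fun _ : Unit => (-1 : ℂ)) * g = -g by ext; simp] at this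

lemma Conv.sub (h : Conv l n f g) (h' : Conv l n f' g') : Conv l n (f - f') (g - g') := by
  rw [sub_eq_add_neg, sub_eq_add_neg]
  exact h.add h'.neg

lemma Conv.cj (h : Conv l n f g) : Conv l n (cj f) (cj g) := by
  induction n generalizing f g with
  | zero => exact fun x => (Complex.continuous_conj.tendsto _).comp (h.tendsto x)
  | succ n ih =>
    refine ⟨fun x => (Complex.continuous_conj.tendsto _).comp (h.tendsto x), fun i => ?_⟩
    rw [der_cj, der_cj]
    exact ih (h.2 i)

lemma Conv.cov {a : Fin 2 → Sm ι} {b : Fin 2 → Sm Unit} (ha : ∀ i, Conv l n (a i) (b i)) (q : ℤ)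
    (h : Conv l (n + 1) f g) (i : Fin 2) : Conv l n (cov a q i f) (cov b q i g) :=
  (h.2 i).add ((((Conv.const I).mul (Conv.const (q : ℂ))).mul (ha i)).mul h.of_succ)

end Sm

namespace Sm

lemma GLEq.limit {ι : Type} {α β : ℝ} {l : ℕ → ι} {F φ : Sm ι} {a : Fin 2 → Sm ι}
    {G ψ : Sm Unit} {b : Fin 2 → Sm Unit} (h : GLEq α β F a φ) (hF : Conv l 1 F G)
    (ha : ∀ i, Conv l 2 (a i) (b i)) (hφ : Conv l 2 φ ψ) : GLEq α β G b ψ := by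
  have hc : Conv l 1 (crv a 0 1 - F) (crv b 0 1 - G) := (((ha 1).2 0).sub ((ha 0).2 1)).sub hF
  have hcov : ∀ i, Conv l 1 (cov a 1 i φ) (cov b 1 i ψ) := fun i =>
    Conv.cov (fun i => (ha i).of_succ) 1 hφ i
  have h0 : Conv l 0 φ ψ := hφ.of_succ.of_succ
  have hcur : ∀ i, Conv l 0 (cj φ * cov a 1 i φ + cst (fun _ => -1) * (φ * cj (cov a 1 i φ)))
      (cj ψ * cov b 1 i ψ + cst (fun _ => -1) * (ψ * cj (cov b 1 i ψ))) := fun i =>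
    (h0.cj.mul (hcov i).of_succ).add ((Conv.const _).mul (h0.mul (hcov i).of_succ.cj))
  refine ⟨(hc.2 1).unique ?_, (hc.2 0).unique ?_, Conv.unique (l := l) (n := 0) (f := lap a 1 φ) ?_ ?_⟩
  · rw [h.eq_one]
    exact (Conv.const _).mul (hcur 0)
  · rw [h.eq_zero]
    exact (Conv.const _).mul (hcur 1)
  · simp only [lap, Fin.sum_univ_two]
    exact (Conv.cov (fun i => (ha i).of_succ.of_succ) 1 (hcov 0) 0).add
      (Conv.cov (fun i => (ha i).of_succ.of_succ) 1 (hcov 1) 1)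
  · rw [h.eq_lap]
    exact ((Conv.const _).mul h0).add ((Conv.const _).mul ((h0.mul h0.cj).mul h0))

lemma Conv.tendsto_sqL2 {E : Type*} [NormedAddCommGroup E] {ι : Type} {l : ℕ → ι} {f : Sm ι}
    {g : Sm Unit} (h : Conv l 0 f g) (hf : LB 0 f) {u : ℕ → ℝ × ℝ → E}
    (hu : ∀ m x, ‖u m x‖ = ‖f.1 (l m) x - g.1 () x‖) :
    Filter.Tendsto (fun m => sqL2 (u m)) Filter.atTop (nhds 0) := by
  simp only [sqL2, hu]
  obtain ⟨C, hC⟩ := hf 1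
  have hg : ∀ x, ‖x‖ ≤ 1 → ‖g.1 () x‖ ≤ C := fun x hx =>
    le_of_tendsto (h.tendsto x).norm (.of_forall fun m => hC _ x hx)
  have hsq : ∀ x ∈ unitSquare, ‖x‖ ≤ 1 := fun x hx => by
    obtain ⟨⟨h1, h2⟩, h3, h4⟩ := hx
    simp only at h1 h2 h3 h4
    rw [Prod.norm_def, Real.norm_of_nonneg h1, Real.norm_of_nonneg h2]
    exact max_le h3 h4
  have := tendsto_integral_of_dominated_convergence (μ := volume.restrict unitSquare)
    (F := fun m x => ‖f.1 (l m) x - g.1 () x‖ ^ 2) (f := fun _ => 0) (fun _ => (C + C) ^ 2)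
    (fun m => by
      have := (smooth f (l m)).continuous
      have := (smooth g ()).continuous
      exact Continuous.aestronglyMeasurable (by fun_prop))
    (integrableOn_const isCompact_unitSquare.measure_lt_top.ne)
    (fun m => by
      filter_upwards [ae_restrict_mem isCompact_unitSquare.measurableSet] with x hx
      rw [norm_pow, norm_norm]
      gcongr
      exact (_root_.norm_sub_le _ _).trans (add_le_add (hC _ x (hsq x hx)) (hg x (hsq x hx))))
    (.of_forall fun x => by
      have := ((h.tendsto x).sub_const (g.1 () x)).norm.pow 2
      simpa using this)
  simpa using this

variable {d : ℤ}

lemma Conv.fld {ι : Type} (l : ℕ → ι) (n : ℕ) {F₀ : ℝ × ℝ → ℝ} (hF₀ : ExternalField d F₀) :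
    Conv l n (fld ι hF₀) (fld Unit hF₀) := by
  have key : ∀ (n : ℕ) (f : Sm ι) (g : Sm Unit), (∀ k, f.1 k = g.1 ()) → Conv l n f g := by
    intro n
    induction n with
    | zero => exact fun f g hfg x => by simp only [hfg]; exact tendsto_const_nhds
    | succ n ih =>
      refine fun f g hfg => ⟨fun x => by simp only [hfg]; exact tendsto_const_nhds, fun i =>
        ih _ _ fun k => ?_⟩
      funext x
      rw [der_ev, der_ev, hfg]
  exact key n _ _ fun _ => rfl

/-- The field pair of a limit. -/
theorem exists_fieldPair {P : ℕ → FieldPair d} {l : ℕ → ℕ} {b : Fin 2 → Sm Unit} {ψ : Sm Unit}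
    (hb : ∀ i, Conv l 0 (pot P i) (b i)) (hψ : Conv l 0 (sec P) ψ) :
    ∃ Q : FieldPair d, pot (fun _ : Unit => Q) = b ∧ sec (fun _ : Unit => Q) = ψ := by
  have hre : ∀ i x, (((b i).1 () x).re : ℂ) = (b i).1 () x := fun i x => by
    have h1 : Conv l 0 (cj (pot P i)) (cj (b i)) := (hb i).cj
    have h2 : cj (pot P i) = pot P i := by
      fin_cases i
      · exact cj_ofRe _ fun k => (P k).smooth_a1
      · exact cj_ofRe _ fun k => (P k).smooth_a2
    rw [h2] at h1
    have h3 := h1.unique (hb i)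
    exact Complex.conj_eq_iff_re.1 (by rw [← cj_ev, h3])
  have hlim : ∀ i x, Filter.Tendsto (fun m => ((pot P i).1 (l m) x).re) Filter.atTop
      (nhds ((b i).1 () x).re) := fun i x =>
    (Complex.continuous_re.tendsto _).comp ((hb i).tendsto x)
  have h1 : ∀ x, Filter.Tendsto (fun m => (P (l m)).a1 x) Filter.atTop
      (nhds ((b 0).1 () x).re) := hlim 0
  have h2 : ∀ x, Filter.Tendsto (fun m => (P (l m)).a2 x) Filter.atTop
      (nhds ((b 1).1 () x).re) := hlim 1
  have h3 : ∀ x, Filter.Tendsto (fun m => (P (l m)).φ x) Filter.atTop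
      (nhds (ψ.1 () x)) := hψ.tendsto
  refine ⟨{ a1 := fun x => ((b 0).1 () x).re
            a2 := fun x => ((b 1).1 () x).re
            φ := ψ.1 ()
            smooth_a1 := Complex.reCLM.contDiff.comp (smooth (b 0) ())
            smooth_a2 := Complex.reCLM.contDiff.comp (smooth (b 1) ())
            smooth_φ := smooth ψ ()
            per1_a1 := fun x => tendsto_nhds_unique (h1 _) (by
              simpa only [FieldPair.per1_a1] using h1 x)
            per1_a2 := fun x => tendsto_nhds_unique (h2 _) (by
              simpa only [FieldPair.per1_a2] using h2 x)
            per1_φ := fun x => tendsto_nhds_unique (h3 _) (by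
              simpa only [FieldPair.per1_φ] using h3 x)
            per2_a2 := fun x => tendsto_nhds_unique (h2 _) (by
              simpa only [FieldPair.per2_a2] using h2 x)
            per2_a1 := fun x => tendsto_nhds_unique (h1 _) (by
              simpa only [FieldPair.per2_a1] using (h1 x).sub_const (2 * Real.pi * d))
            per2_φ := fun x => tendsto_nhds_unique (h3 _) (by
              simpa only [FieldPair.per2_φ] using (h3 x).const_mul _) }, ?_, ?_⟩
  · funext i
    ext k x
    fin_cases i
    · exact hre 0 x
    · exact hre 1 x
  · rfl

/-- Families of solutions in axial gauge are bounded with all derivatives on bounded sets. -/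
theorem lb_of_axial {ι : Type} {α β : ℝ} (hα : 0 < α) (hβ : 0 < β) {F₀ : ℝ × ℝ → ℝ}
    (hF₀ : ExternalField d F₀) {P : ι → FieldPair d} (hP : ∀ k, IsGLSolution α β F₀ (P k))
    (h1 : ∀ k x, pd2 (P k).a2 x = 0) {M : ℝ}
    (h2 : ∀ k, ∃ c, |c| ≤ M ∧ ∀ s : ℝ, (P k).a1 (s, 0) = c) (h3 : ∀ k, |(P k).a2 (0, 0)| ≤ M)
    (n : ℕ) : (∀ i, LB n (pot P i)) ∧ LB n (sec P) := by
  have h := isGL hF₀ P hP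
  choose c hc hc' using h2
  have ha : ∀ n, LB n (pot P 0) ∧ LB n (pot P 1) := fun n => by
    refine LB.axial (κ := fun _ => ((-(2 * Real.pi * d) : ℝ) : ℂ)) (κ' := fun k => (c k : ℂ))
      (K := max |2 * Real.pi * d| M) ?_ ?_ (fun k => ?_) (fun k => ?_) (fun k s => ?_)
      (fun k s => ?_) ⟨M, fun k => ?_⟩
    · exact ((h.est_curvature hα hβ n 0 1).of_succ fun _ _ => le_rfl).lb_curvature
    · ext k x
      have := h1 k x
      rw [pd2] at this
      simp [pot, der_ofRe, dir, this]
    · rw [Complex.norm_real, norm_neg]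
      exact le_max_left _ _
    · rw [Complex.norm_real]
      exact (hc k).trans (le_max_right _ _)
    · have := (P k).per2_a1 (s, 0)
      simp only [zero_add] at this
      simp [pot, ofRe_ev, this]
    · simp [pot, ofRe_ev, hc']
    · simpa [pot, ofRe_ev] using h3 k
  have ha' : ∀ n i, LB n (pot P i) := fun n i => by
    fin_cases i
    · exact (ha n).1
    · exact (ha n).2
  exact ⟨ha' n, (h.est hα hβ n).lb ha'⟩

end Sm

lemma tendsto_sqL2_re {l : ℕ → ℕ} {u : ℕ → ℝ × ℝ → ℝ} {v : ℝ × ℝ → ℝ}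
    (hu : ∀ k, ContDiff ℝ (⊤ : ℕ∞) (u k)) (hv : ContDiff ℝ (⊤ : ℕ∞) v)
    (h : Sm.Conv l 1 (Sm.ofRe u hu) (Sm.ofRe (fun _ => v) fun _ => hv)) (hb : Sm.LB 1 (Sm.ofRe u hu)) :
    Filter.Tendsto (fun m => sqL2 fun x => u (l m) x - v x) Filter.atTop (nhds 0) ∧
    Filter.Tendsto (fun m => sqL2 (pd1 fun x => u (l m) x - v x)) Filter.atTop (nhds 0) ∧
    Filter.Tendsto (fun m => sqL2 (pd2 fun x => u (l m) x - v x)) Filter.atTop (nhds 0) := by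
  have hd : ∀ m x, fderiv ℝ (fun x => u (l m) x - v x) x = fderiv ℝ (u (l m)) x - fderiv ℝ v x :=
    fun m x => fderiv_fun_sub ((hu _).differentiable (by simp) x) (hv.differentiable (by simp) x)
  refine ⟨h.of_succ.tendsto_sqL2 hb.to_zero fun m x => ?_,
    (h.2 0).tendsto_sqL2 (hb.2 0) fun m x => ?_, (h.2 1).tendsto_sqL2 (hb.2 1) fun m x => ?_⟩
  · rw [Sm.ofRe_ev, Sm.ofRe_ev, ← Complex.ofReal_sub, Complex.norm_real]
  · rw [Sm.der_ofRe, Sm.der_ofRe, ← Complex.ofReal_sub, Complex.norm_real, pd1, hd]; rfl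
  · rw [Sm.der_ofRe, Sm.der_ofRe, ← Complex.ofReal_sub, Complex.norm_real, pd2, hd]; rfl

lemma tendsto_sqL2_sec {l : ℕ → ℕ} {f : Sm ℕ} {g : Sm Unit} (h : Sm.Conv l 1 f g)
    (hb : Sm.LB 1 f) :
    Filter.Tendsto (fun m => sqL2 fun x => f.1 (l m) x - g.1 () x) Filter.atTop (nhds 0) ∧
    Filter.Tendsto (fun m => sqL2 (pd1 fun x => f.1 (l m) x - g.1 () x)) Filter.atTop (nhds 0) ∧
    Filter.Tendsto (fun m => sqL2 (pd2 fun x => f.1 (l m) x - g.1 () x)) Filter.atTop (nhds 0) := by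
  have hd : ∀ m x, fderiv ℝ (fun x => f.1 (l m) x - g.1 () x) x =
      fderiv ℝ (f.1 (l m)) x - fderiv ℝ (g.1 ()) x :=
    fun m x => fderiv_fun_sub (Sm.diff f _ x) (Sm.diff g _ x)
  refine ⟨h.of_succ.tendsto_sqL2 hb.to_zero fun m x => rfl,
    (h.2 0).tendsto_sqL2 (hb.2 0) fun m x => ?_, (h.2 1).tendsto_sqL2 (hb.2 1) fun m x => ?_⟩
  · rw [pd1, hd]; rfl
  · rw [pd2, hd]; rfl

/-- sequential compactness, up to gauge, of the moduli space of
degree-`d` GL solutions in the `W^{1,2}` topology. -/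
theorem statement13 (α β : ℝ) (hα : 0 < α) (hβ : 0 < β) (d : ℤ) (F₀ : ℝ × ℝ → ℝ)
    (hF₀ : ExternalField d F₀) (P : ℕ → FieldPair d)
    (hP : ∀ k : ℕ, IsGLSolution α β F₀ (P k)) :
    ∃ (k : ℕ → ℕ), StrictMono k ∧
    ∃ (g : ℕ → ℝ × ℝ → ℂ) (Q : FieldPair d),
      (∀ l : ℕ, ContDiff ℝ (⊤ : ℕ∞) (g l)) ∧
      (∀ l : ℕ, ∀ x : ℝ × ℝ, g l (x.1 + 1, x.2) = g l x) ∧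
      (∀ l : ℕ, ∀ x : ℝ × ℝ, g l (x.1, x.2 + 1) = g l x) ∧
      (∀ l : ℕ, ∀ x : ℝ × ℝ, ‖g l x‖ = 1) ∧
      IsGLSolution α β F₀ Q ∧
      Filter.Tendsto (fun l : ℕ =>
        sqL2 (fun x => gaugeA1 (g l) (P (k l)).a1 x - Q.a1 x)) Filter.atTop (nhds 0) ∧
      Filter.Tendsto (fun l : ℕ =>
        sqL2 (fun x => gaugeA2 (g l) (P (k l)).a2 x - Q.a2 x)) Filter.atTop (nhds 0) ∧
      Filter.Tendsto (fun l : ℕ =>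
        sqL2 (fun x => gaugePhi (g l) (P (k l)).φ x - Q.φ x)) Filter.atTop (nhds 0) ∧
      Filter.Tendsto (fun l : ℕ =>
        sqL2 (pd1 (fun x => gaugeA1 (g l) (P (k l)).a1 x - Q.a1 x))) Filter.atTop (nhds 0) ∧
      Filter.Tendsto (fun l : ℕ =>
        sqL2 (pd2 (fun x => gaugeA1 (g l) (P (k l)).a1 x - Q.a1 x))) Filter.atTop (nhds 0) ∧
      Filter.Tendsto (fun l : ℕ =>
        sqL2 (pd1 (fun x => gaugeA2 (g l) (P (k l)).a2 x - Q.a2 x))) Filter.atTop (nhds 0) ∧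
      Filter.Tendsto (fun l : ℕ =>
        sqL2 (pd2 (fun x => gaugeA2 (g l) (P (k l)).a2 x - Q.a2 x))) Filter.atTop (nhds 0) ∧
      Filter.Tendsto (fun l : ℕ =>
        sqL2 (pd1 (fun x => gaugePhi (g l) (P (k l)).φ x - Q.φ x))) Filter.atTop (nhds 0) ∧
      Filter.Tendsto (fun l : ℕ =>
        sqL2 (pd2 (fun x => gaugePhi (g l) (P (k l)).φ x - Q.φ x))) Filter.atTop (nhds 0) := by
  choose χ h h1 h2 h3 using fun k => (P k).exists_axial_phase
  have hP' : ∀ k, IsGLSolution α β F₀ ((h k).act (P k)) := fun k =>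
    (h k).isGLSolution_act hF₀ (hP k)
  have hb := Sm.lb_of_axial hα hβ hF₀ hP' h1 h2 h3
  obtain ⟨l, hl, f, hf⟩ := Sm.exists_conv
    (fun j : Option (Fin 2) => j.elim (Sm.sec fun k => (h k).act (P k))
      (Sm.pot fun k => (h k).act (P k)))
    fun j n => by
      cases j with
      | none => exact (hb n).2
      | some i => exact (hb n).1 i
  obtain ⟨Q, hQ, hQ'⟩ := Sm.exists_fieldPair (fun i => hf (some i) 0) (hf none 0)
  have ca : ∀ n i, Sm.Conv l n (Sm.pot (fun k => (h k).act (P k)) i)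
      (Sm.pot (fun _ : Unit => Q) i) := fun n i => by
    rw [hQ]; exact hf (some i) n
  have cφ : ∀ n, Sm.Conv l n (Sm.sec fun k => (h k).act (P k)) (Sm.sec fun _ : Unit => Q) :=
    fun n => by rw [hQ']; exact hf none n
  have t1 := tendsto_sqL2_re (fun k => ((h k).act (P k)).smooth_a1) Q.smooth_a1 (ca 1 0)
    ((hb 1).1 0)
  have t2 := tendsto_sqL2_re (fun k => ((h k).act (P k)).smooth_a2) Q.smooth_a2 (ca 1 1)
    ((hb 1).1 1)
  have t3 := tendsto_sqL2_sec (cφ 1) (hb 1).2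
  refine ⟨l, hl, fun m => IsPhase.toFun (χ (l m)), Q, fun m => (h _).contDiff_toFun,
    fun m => (h _).per_toFun.1, fun m => (h _).per_toFun.2, fun m => IsPhase.norm_toFun _, ?_, ?_⟩
  · refine (Sm.glEq_iff hF₀ fun _ : Unit => Q).1 ?_ ()
    exact ((Sm.glEq_iff hF₀ _).2 hP').limit (Sm.Conv.fld l 1 hF₀) (ca 2) (cφ 2)
  · simp only [(h _).gaugeA1_eq, (h _).gaugeA2_eq]
    exact ⟨t1.1, t2.1, t3.1, t1.2.1, t1.2.2, t2.2.1, t2.2.2, t3.2.1, t3.2.2⟩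
end
end

section
/- Every GL solution with de Gennes–Neumann boundary conditions (a,φ) satisfies the pointwise bound |φ(x)| ≤ √(α/β) for all x ∈ D̄. -/
open MeasureTheory Complex

noncomputable section

/-- The closed unit disk `D̄ ⊆ ℝ²`. -/
def disk : Set (ℝ × ℝ) := { x : ℝ × ℝ | x.1 ^ 2 + x.2 ^ 2 ≤ 1 }

/-- A field pair on the disk: a pair of smooth maps `(a, φ)`. -/
structure DiskPair where
  a1 : ℝ × ℝ → ℝ
  a2 : ℝ × ℝ → ℝ
  φ : ℝ × ℝ → ℂ
  smooth_a1 : ContDiff ℝ (⊤ : ℕ∞) a1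
  smooth_a2 : ContDiff ℝ (⊤ : ℕ∞) a2
  smooth_φ : ContDiff ℝ (⊤ : ℕ∞) φ

/-- The Ginzburg–Landau free energy on the disk. -/
def energyD (α β : ℝ) (F₀ : ℝ × ℝ → ℝ) (P : DiskPair) : ℝ :=
  (1 / 2) * ∫ x in disk,
    ((curv P.a1 P.a2 x - F₀ x) ^ 2 + ‖D1 P.a1 P.φ x‖ ^ 2 + ‖D2 P.a2 P.φ x‖ ^ 2
      - α * ‖P.φ x‖ ^ 2 + (β / 2) * ‖P.φ x‖ ^ 4)

/-- The Ginzburg–Landau equations on the disk with de Gennes–Neumann boundary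
conditions. -/
def IsGLSolutionD (α β : ℝ) (F₀ : ℝ × ℝ → ℝ) (P : DiskPair) : Prop :=
  (∀ x ∈ disk,
      pd2 (fun y => curv P.a1 P.a2 y - F₀ y) x
        + ((starRingEnd ℂ) (P.φ x) * D1 P.a1 P.φ x).im = 0) ∧
  (∀ x ∈ disk,
      -pd1 (fun y => curv P.a1 P.a2 y - F₀ y) x
        + ((starRingEnd ℂ) (P.φ x) * D2 P.a2 P.φ x).im = 0) ∧
  (∀ x ∈ disk,
      -(D1 P.a1 (D1 P.a1 P.φ) x + D2 P.a2 (D2 P.a2 P.φ) x)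
        = (α : ℂ) * P.φ x - (β : ℂ) * (‖P.φ x‖ : ℂ) ^ 2 * P.φ x) ∧
  (∀ x : ℝ × ℝ, x.1 ^ 2 + x.2 ^ 2 = 1 →
      curv P.a1 P.a2 x = F₀ x ∧
      (x.1 : ℂ) * D1 P.a1 P.φ x + (x.2 : ℂ) * D2 P.a2 P.φ x = 0)

/-- The set of energies of all field pairs on the disk. -/
def energySetD (α β : ℝ) (F₀ : ℝ × ℝ → ℝ) : Set ℝ :=
  { t : ℝ | ∃ P : DiskPair, t = energyD α β F₀ P }

/-- `λ₁` on the disk. -/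
def lambda1D (F₀ : ℝ × ℝ → ℝ) : ℝ :=
  sInf { t : ℝ | ∃ P : DiskPair,
    (∀ x ∈ disk, curv P.a1 P.a2 x = F₀ x) ∧
    (∫ x in disk, ‖P.φ x‖ ^ 2) = 1 ∧
    t = ∫ x in disk, (‖D1 P.a1 P.φ x‖ ^ 2 + ‖D2 P.a2 P.φ x‖ ^ 2) }

/-- One-sided first and second order necessary conditions for a maximum at an endpoint. -/
theorem one_sided_max_conditions {g g' : ℝ → ℝ} {c : ℝ} (hg : ∀ t, HasDerivAt g (g' t) t)
    (hc : HasDerivAt g' c 0) (hmax : ∀ᶠ t in nhdsWithin 0 (Set.Ioi 0), g t ≤ g 0) :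
    g' 0 ≤ 0 ∧ (g' 0 = 0 → c ≤ 0) := by
  have hpos : ¬ ∀ᶠ t in nhdsWithin (0 : ℝ) (Set.Ioi 0), 0 < g' t := by
    intro hev
    obtain ⟨δ, hδ, h⟩ := mem_nhdsGT_iff_exists_Ioo_subset.1 (hev.and hmax)
    have hδ : (0 : ℝ) < δ := hδ
    have hmono : StrictMonoOn g (Set.Icc 0 (δ / 2)) := by
      apply strictMonoOn_of_deriv_pos (convex_Icc _ _)
        (fun t _ => (hg t).continuousAt.continuousWithinAt)
      intro t ht
      rw [interior_Icc] at ht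
      rw [(hg t).deriv]
      exact (h ⟨ht.1, by linarith [ht.2]⟩).1
    have hlt := hmono (Set.left_mem_Icc.2 (by positivity)) (Set.right_mem_Icc.2 (by positivity))
      (show (0 : ℝ) < δ / 2 by positivity)
    have hle : g (δ / 2) ≤ g 0 :=
      (h (show δ / 2 ∈ Set.Ioo 0 δ from ⟨by positivity, by linarith⟩)).2
    linarith
  constructor
  · by_contra! h
    exact hpos (nhdsWithin_le_nhds (hc.continuousAt.eventually (lt_mem_nhds h)))
  · intro h0
    by_contra! h
    apply hpos
    have hs := hc.tendsto_slope.eventually (lt_mem_nhds h)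
    have hs' := hs.filter_mono (nhdsWithin_mono 0 (fun t (ht : 0 < t) => ht.ne'))
    filter_upwards [hs', self_mem_nhdsWithin] with t ht (htp : 0 < t)
    rw [slope_def_field, h0, sub_zero, sub_zero] at ht
    exact (div_pos_iff_of_pos_right htp).1 ht

/-- Necessary conditions for `‖φ‖` to be maximal at `x` along the ray in direction `v`. -/
theorem norm_max_along_ray {F E : Type*} [NormedAddCommGroup F] [NormedSpace ℝ F]
    [NormedAddCommGroup E] [InnerProductSpace ℝ E] {φ : F → E} (hφ : ContDiff ℝ 2 φ) (x v : F)
    (hmax : ∀ᶠ t : ℝ in nhdsWithin 0 (Set.Ioi 0), ‖φ (x + t • v)‖ ≤ ‖φ x‖) :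
    inner ℝ (φ x) (fderiv ℝ φ x v) ≤ 0 ∧
      (inner ℝ (φ x) (fderiv ℝ φ x v) = 0 →
        ‖fderiv ℝ φ x v‖ ^ 2 + inner ℝ (φ x) (fderiv ℝ (fun y => fderiv ℝ φ y v) x v) ≤ 0) := by
  have hline : ∀ t : ℝ, HasDerivAt (fun t : ℝ => x + t • v) v t := fun t => by
    simpa using ((hasDerivAt_id t).smul_const v).const_add x
  have hW : ∀ t : ℝ, HasDerivAt (fun t : ℝ => φ (x + t • v)) (fderiv ℝ φ (x + t • v) v) t :=
    fun t => ((hφ.differentiable (by norm_num)) _).hasFDerivAt.comp_hasDerivAt t (hline t)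
  have hdiff : Differentiable ℝ (fun y => fderiv ℝ φ y v) :=
    ((hφ.fderiv_right (m := 1) (by norm_num)).clm_apply contDiff_const).differentiable
      (by norm_num)
  have hW' : HasDerivAt (fun t : ℝ => fderiv ℝ φ (x + t • v) v)
      (fderiv ℝ (fun y => fderiv ℝ φ y v) (x + (0 : ℝ) • v) v) 0 :=
    (hdiff _).hasFDerivAt.comp_hasDerivAt (0 : ℝ) (hline 0)
  have key := one_sided_max_conditions (fun t => (hW t).norm_sq)
    (((hW 0).inner ℝ hW').const_mul 2) (by
      filter_upwards [hmax] with t ht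
      simpa using pow_le_pow_left₀ (norm_nonneg _) ht 2)
  simp only [zero_smul, add_zero, real_inner_self_eq_norm_sq] at key
  refine ⟨by linarith [key.1], fun h => ?_⟩
  linarith [key.2 (by rw [h, mul_zero])]

theorem isCompact_disk : IsCompact disk := by
  apply (isCompact_Icc (a := ((-1, -1) : ℝ × ℝ)) (b := (1, 1))).of_isClosed_subset
  · exact isClosed_le (by fun_prop) continuous_const
  · rintro ⟨x, y⟩ h
    have h : x ^ 2 + y ^ 2 ≤ 1 := h
    refine ⟨⟨?_, ?_⟩, ⟨?_, ?_⟩⟩ <;> dsimp only <;> nlinarith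

theorem fderiv_apply_eq_pd {E : Type*} [NormedAddCommGroup E] [NormedSpace ℝ E]
    (f : ℝ × ℝ → E) (x v : ℝ × ℝ) : fderiv ℝ f x v = v.1 • pd1 f x + v.2 • pd2 f x := by
  rw [pd1, pd2, ← map_smul, ← map_smul, ← map_add]
  simp

theorem differentiable_pd1 {f : ℝ × ℝ → ℂ} (hf : ContDiff ℝ 2 f) : Differentiable ℝ (pd1 f) :=
  ((hf.fderiv_right (m := 1) (by norm_num)).clm_apply contDiff_const).differentiable
    (by norm_num)

theorem differentiable_pd2 {f : ℝ × ℝ → ℂ} (hf : ContDiff ℝ 2 f) : Differentiable ℝ (pd2 f) :=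
  ((hf.fderiv_right (m := 1) (by norm_num)).clm_apply contDiff_const).differentiable
    (by norm_num)

theorem fderiv_fderiv_apply_eq_pd {f : ℝ × ℝ → ℂ} (hf : ContDiff ℝ 2 f) (x v : ℝ × ℝ) :
    fderiv ℝ (fun y => fderiv ℝ f y v) x v =
      v.1 • (v.1 • pd1 (pd1 f) x + v.2 • pd2 (pd1 f) x) +
        v.2 • (v.1 • pd1 (pd2 f) x + v.2 • pd2 (pd2 f) x) := by
  have h1 := differentiable_pd1 hf x
  have h2 := differentiable_pd2 hf x
  have : (fun y => fderiv ℝ f y v) = fun y => v.1 • pd1 f y + v.2 • pd2 f y :=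
    funext fun y => fderiv_apply_eq_pd f y v
  rw [this, ((h1.hasFDerivAt.fun_const_smul v.1).fun_add
    (h2.hasFDerivAt.fun_const_smul v.2)).fderiv]
  simp only [add_apply, smul_apply, fderiv_apply_eq_pd]

theorem fderiv_covariant_apply {A f : ℝ × ℝ → ℂ} {a : ℝ × ℝ → ℝ} {x : ℝ × ℝ}
    (hA : DifferentiableAt ℝ A x) (ha : DifferentiableAt ℝ a x) (hf : DifferentiableAt ℝ f x)
    (v : ℝ × ℝ) :
    fderiv ℝ (fun y => A y + Complex.I * (a y : ℂ) * f y) x v =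
      fderiv ℝ A x v + Complex.I * (fderiv ℝ a x v : ℂ) * f x +
        Complex.I * (a x : ℂ) * fderiv ℝ f x v := by
  have h := hA.hasFDerivAt.add
    (((Complex.ofRealCLM.hasFDerivAt.comp x ha.hasFDerivAt).const_mul Complex.I).mul hf.hasFDerivAt)
  have h' := h.fderiv
  simp only [Function.comp_def, Complex.ofRealCLM_apply] at h'
  change fderiv ℝ (fun y => A y + Complex.I * (a y : ℂ) * f y) x = _ at h'
  rw [h']
  simp
  ring

/-- The Bochner-type identity `½ Δ|φ|² = |Dφ|² + Re (conj φ · D²φ)` at a point. -/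
theorem half_laplacian_normSq {f : ℝ × ℝ → ℂ} {a1 a2 : ℝ × ℝ → ℝ} (hf : ContDiff ℝ 2 f)
    (ha1 : Differentiable ℝ a1) (ha2 : Differentiable ℝ a2) (x : ℝ × ℝ) :
    ‖pd1 f x‖ ^ 2 + ‖pd2 f x‖ ^ 2 + inner ℝ (f x) (pd1 (pd1 f) x + pd2 (pd2 f) x) =
      ‖D1 a1 f x‖ ^ 2 + ‖D2 a2 f x‖ ^ 2 +
        inner ℝ (f x) (D1 a1 (D1 a1 f) x + D2 a2 (D2 a2 f) x) := by
  have hd := hf.differentiable (by norm_num)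
  have e1 : D1 a1 (D1 a1 f) x = fderiv ℝ (pd1 f) x (1, 0) +
      Complex.I * (fderiv ℝ a1 x (1, 0) : ℂ) * f x + Complex.I * (a1 x : ℂ) * fderiv ℝ f x (1, 0)
      + Complex.I * (a1 x : ℂ) * (pd1 f x + Complex.I * (a1 x : ℂ) * f x) := by
    rw [← fderiv_covariant_apply (differentiable_pd1 hf x) (ha1 x) (hd x)]
    rfl
  have e2 : D2 a2 (D2 a2 f) x = fderiv ℝ (pd2 f) x (0, 1) +
      Complex.I * (fderiv ℝ a2 x (0, 1) : ℂ) * f x + Complex.I * (a2 x : ℂ) * fderiv ℝ f x (0, 1)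
      + Complex.I * (a2 x : ℂ) * (pd2 f x + Complex.I * (a2 x : ℂ) * f x) := by
    rw [← fderiv_covariant_apply (differentiable_pd2 hf x) (ha2 x) (hd x)]
    rfl
  rw [e1, e2]
  simp only [← Complex.normSq_eq_norm_sq, Complex.normSq_apply, Complex.inner, D1, D2, pd1, pd2]
  simp
  ring

/-- At a maximum of `‖f‖` over the disk where the normal derivative of `‖f‖²` vanishes if the point
lies on the boundary circle, the Laplacian of `‖f‖²` is nonpositive. -/
theorem laplacian_normSq_nonpos_of_max {f : ℝ × ℝ → ℂ} (hf : ContDiff ℝ 2 f) {x : ℝ × ℝ}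
    (hx : x ∈ disk) (hmax : ∀ y ∈ disk, ‖f y‖ ≤ ‖f x‖)
    (hN : x.1 ^ 2 + x.2 ^ 2 = 1 → inner ℝ (f x) (x.1 • pd1 f x + x.2 • pd2 f x) = 0) :
    ‖pd1 f x‖ ^ 2 + ‖pd2 f x‖ ^ 2 + inner ℝ (f x) (pd1 (pd1 f) x + pd2 (pd2 f) x) ≤ 0 := by
  have ray : ∀ v : ℝ × ℝ, (∀ᶠ t : ℝ in nhdsWithin 0 (Set.Ioi 0), x + t • v ∈ disk) → _ :=
    fun v hv => norm_max_along_ray hf x v (hv.mono fun t ht => hmax _ ht)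
  simp only [fderiv_fderiv_apply_eq_pd hf] at ray
  simp only [fderiv_apply_eq_pd f] at ray
  have hx' : x.1 ^ 2 + x.2 ^ 2 ≤ 1 := hx
  rcases hx'.lt_or_eq with hlt | heq
  · have hin : ∀ v : ℝ × ℝ, ∀ᶠ t : ℝ in nhdsWithin 0 (Set.Ioi 0), x + t • v ∈ disk := by
      intro v
      apply nhdsWithin_le_nhds
      have hc : Continuous fun t : ℝ => (x.1 + t * v.1) ^ 2 + (x.2 + t * v.2) ^ 2 := by fun_prop
      exact (hc.continuousAt.eventually_lt continuousAt_const (by simpa using hlt)).mono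
        fun t ht => le_of_lt ht
    have p1 := ray (1, 0) (hin _)
    have m1 := (ray (-1, 0) (hin _)).1
    have p2 := ray (0, 1) (hin _)
    have m2 := (ray (0, -1) (hin _)).1
    simp only [one_smul, zero_smul, add_zero, zero_add, neg_smul, inner_neg_right] at p1 p2 m1 m2
    have q1 := p1.2 (le_antisymm p1.1 (by linarith))
    have q2 := p2.2 (le_antisymm p2.1 (by linarith))
    rw [inner_add_right]
    linarith
  · have p := ray (-x.1 - x.2, x.1 - x.2) (by
      filter_upwards [Ioo_mem_nhdsGT one_pos] with t ht
      change (x.1 + t * (-x.1 - x.2)) ^ 2 + (x.2 + t * (x.1 - x.2)) ^ 2 ≤ 1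
      have e : (x.1 + t * (-x.1 - x.2)) ^ 2 + (x.2 + t * (x.1 - x.2)) ^ 2 =
        (x.1 ^ 2 + x.2 ^ 2) * (1 - 2 * (t * (1 - t))) := by ring
      rw [e, heq]
      nlinarith [ht.1, ht.2])
    have q := ray (-x.1 + x.2, -x.1 - x.2) (by
      filter_upwards [Ioo_mem_nhdsGT one_pos] with t ht
      change (x.1 + t * (-x.1 + x.2)) ^ 2 + (x.2 + t * (-x.1 - x.2)) ^ 2 ≤ 1
      have e : (x.1 + t * (-x.1 + x.2)) ^ 2 + (x.2 + t * (-x.1 - x.2)) ^ 2 =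
        (x.1 ^ 2 + x.2 ^ 2) * (1 - 2 * (t * (1 - t))) := by ring
      rw [e, heq]
      nlinarith [ht.1, ht.2])
    have hN := hN heq
    simp only [← real_inner_self_eq_norm_sq, inner_add_right, inner_add_left, inner_smul_left,
      inner_smul_right, conj_trivial] at p q hN ⊢
    rw [real_inner_comm (pd1 f x) (pd2 f x)] at p q
    have p2 := p.2 (le_antisymm p.1 (by linarith [q.1]))
    have q2 := q.2 (le_antisymm q.1 (by linarith [p.1]))
    have e : ∀ a : ℝ, a = (x.1 ^ 2 + x.2 ^ 2) * a := fun a => by rw [heq, one_mul]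
    rw [e (_ + _)]
    linarith

/-- every GL solution with de Gennes–Neumann boundary conditions
satisfies `|φ| ≤ √(α/β)` on the disk. -/
theorem statement17 (α β : ℝ) (hα : 0 < α) (hβ : 0 < β) (F₀ : ℝ × ℝ → ℝ)
    (hF₀ : ContDiff ℝ (⊤ : ℕ∞) F₀) (P : DiskPair) (hP : IsGLSolutionD α β F₀ P) :
    ∀ x ∈ disk, ‖P.φ x‖ ≤ Real.sqrt (α / β) := by
  obtain ⟨-, -, hGL, hbd⟩ := hP
  have hφ : ContDiff ℝ 2 P.φ := contDiff_infty.1 P.smooth_φ 2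
  have ha1 := P.smooth_a1.differentiable (by norm_num)
  have ha2 := P.smooth_a2.differentiable (by norm_num)
  obtain ⟨m, hm, hmax⟩ := isCompact_disk.exists_isMaxOn ⟨0, by simp [disk]⟩
    (hφ.continuous.norm.continuousOn)
  intro x hx
  refine (hmax hx).trans (Real.le_sqrt_of_sq_le ?_)
  rw [le_div_iff₀ hβ]
  by_contra! hlt
  have hle := laplacian_normSq_nonpos_of_max hφ hm (fun y hy => hmax hy) (fun h => by
    have hb := congrArg (fun z => inner ℝ (P.φ m) z) (hbd m h).2
    simp only [D1, D2, Complex.inner] at hb ⊢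
    simp at hb ⊢
    linarith)
  rw [half_laplacian_normSq hφ ha1 ha2 m, neg_eq_iff_eq_neg.1 (hGL m hm)] at hle
  have hin : inner ℝ (P.φ m) (-((α : ℂ) * P.φ m - (β : ℂ) * (‖P.φ m‖ : ℂ) ^ 2 * P.φ m)) =
      ‖P.φ m‖ ^ 2 * (‖P.φ m‖ ^ 2 * β - α) := by
    have e : -((α : ℂ) * P.φ m - (β : ℂ) * (‖P.φ m‖ : ℂ) ^ 2 * P.φ m) =
        (‖P.φ m‖ ^ 2 * β - α) • P.φ m := by
      rw [Complex.real_smul]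
      push_cast
      ring
    rw [e, inner_smul_right, real_inner_self_eq_norm_sq]
    ring
  rw [hin] at hle
  have hpos : 0 < ‖P.φ m‖ ^ 2 := pos_of_mul_pos_left (hα.trans hlt) hβ.le
  nlinarith [mul_pos hpos (sub_pos.2 hlt), sq_nonneg ‖D1 P.a1 P.φ m‖, sq_nonneg ‖D2 P.a2 P.φ m‖]
end
end
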